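/- arXiv:2501.11180 — 2 statements merged into one kernel-verified Lean document; each statement's English description precedes it below -/
import Mathlib

section
/- Let H be a graph with 0 < v_H ≤ n vertices, e_H > 0 edges, and no isolated vertices. Let W be the number of copies of H in the Erdős–Rényi random graph G(n,p) and λ = E(W). Fix any copy α of H in the complete graph K_n, and for every subgraph H' ⊆ H let Γ^{H',α} denote the set of copies of H in K_n whose intersection with α is H'. Then Var(W) − λ + 2 λ p^{e_H} ≤ λ · ( p^{e_H} + Σ_{H' ⊊ H, e_{H'} > 0} |Γ^{H',α}| · p^{e_H − e_{H'}} ). -/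
open MeasureTheory ProbabilityTheory Filter
open scoped ENNReal NNReal

/-- The Bernoulli distribution on `Bool` with success probability `p`. -/
noncomputable def bernoulliB (p : ℝ) : Measure Bool :=
  ENNReal.ofReal p • Measure.dirac true + ENNReal.ofReal (1 - p) • Measure.dirac false

instance (p : ℝ) : IsFiniteMeasure (bernoulliB p) := by
  constructor
  simp only [bernoulliB, Measure.add_apply, Measure.smul_apply, smul_eq_mul]
  finiteness

/-- The sample space of the Erdős–Rényi random graph `G(n, p)`: one Boolean coordinate for
each potential edge (non-diagonal unordered pair) of the complete graph on `n` vertices. -/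
abbrev EdgeSpace (n : ℕ) := ({e : Sym2 (Fin n) // ¬ e.IsDiag} → Bool)

/-- The Erdős–Rényi measure: each potential edge is present independently with
probability `p`. -/
noncomputable def erMeasure (n : ℕ) (p : ℝ) : Measure (EdgeSpace n) :=
  Measure.pi fun _ => bernoulliB p

/-- The random graph determined by a point of the sample space. -/
def erGraph {n : ℕ} (ω : EdgeSpace n) : SimpleGraph (Fin n) :=
  SimpleGraph.fromEdgeSet {e | ∃ h : ¬ e.IsDiag, ω ⟨e, h⟩ = true}

/-- `B` is a copy of `H` in the complete graph `K_n`: a subgraph of `K_n`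
isomorphic to `H`. -/
def IsCopy {n : ℕ} {V : Type*} (H : SimpleGraph V)
    (B : (⊤ : SimpleGraph (Fin n)).Subgraph) : Prop :=
  Nonempty (B.coe ≃g H)

/-- The number of copies of `H` in `K_n` all of whose edges are present in `G`. -/
noncomputable def numCopies {n : ℕ} {V : Type*} (H : SimpleGraph V)
    (G : SimpleGraph (Fin n)) : ℕ :=
  Set.ncard {B : (⊤ : SimpleGraph (Fin n)).Subgraph | IsCopy H B ∧ B.edgeSet ⊆ G.edgeSet}

instance erM_prob_aux (p : ℝ) [hp : Fact (0 < p ∧ p < 1)] : IsProbabilityMeasure (bernoulliB p) := by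
  constructor
  simp only [bernoulliB, Measure.add_apply, Measure.smul_apply, smul_eq_mul, measure_univ, mul_one]
  rw [← ENNReal.ofReal_add hp.out.1.le (by linarith [hp.out.2])]
  simp

lemma er_prob (n : ℕ) (p : ℝ) [hp : Fact (0 < p ∧ p < 1)] : IsProbabilityMeasure (erMeasure n p) := by
  unfold erMeasure; infer_instance

lemma er_present (n : ℕ) (p : ℝ) [hp : Fact (0 < p ∧ p < 1)] (S : Set (Sym2 (Fin n)))
    (hS : ∀ e ∈ S, ¬ e.IsDiag) :
    (erMeasure n p).real {ω | S ⊆ (erGraph ω).edgeSet} = p ^ S.ncard := by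
  classical
  have h1 : {ω : EdgeSpace n | S ⊆ (erGraph ω).edgeSet} =
      Set.pi Set.univ (fun e => if e.1 ∈ S then {true} else Set.univ) := by
    ext ω
    simp only [Set.mem_ofPred_eq, Set.mem_pi, Set.mem_univ, true_imp_iff, erGraph,
      SimpleGraph.edgeSet_fromEdgeSet]
    constructor
    · intro h e
      split_ifs with he
      · obtain ⟨⟨h1, h2⟩, _⟩ := h he
        simpa using h2
      · trivial
    · intro h e he
      have := h ⟨e, hS e he⟩
      rw [if_pos he] at this
      exact ⟨⟨hS e he, this⟩, hS e he⟩
  rw [h1, erMeasure, measureReal_def, Measure.pi_pi]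
  have h2 : ∀ e : {e : Sym2 (Fin n) // ¬ e.IsDiag},
      bernoulliB p (if e.1 ∈ S then {true} else Set.univ) =
        if e.1 ∈ S then ENNReal.ofReal p else 1 := by
    intro e
    split_ifs
    · simp [bernoulliB]
    · exact measure_univ
  simp_rw [h2]
  rw [Finset.prod_ite, Finset.prod_const_one, mul_one, Finset.prod_const, ENNReal.toReal_pow,
    ENNReal.toReal_ofReal hp.out.1.le]
  congr 1
  rw [← Set.ncard_coe_finset, ← Set.ncard_image_of_injective _ Subtype.val_injective]
  congr 1
  ext e
  simp only [Finset.coe_filter, Finset.mem_univ, true_and, Set.mem_image, Set.mem_ofPred_eq,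
    Subtype.exists, exists_and_left, exists_prop, exists_eq_right_right, and_iff_left_iff_imp]
  exact hS e

lemma subg_nd {n : ℕ} (B : (⊤ : SimpleGraph (Fin n)).Subgraph) : ∀ e ∈ B.edgeSet, ¬ e.IsDiag := by
  intro e he
  exact SimpleGraph.not_isDiag_of_mem_edgeSet _ (B.edgeSet_subset he)

lemma copy_ncard {n v : ℕ} {H : SimpleGraph (Fin v)} {B : (⊤ : SimpleGraph (Fin n)).Subgraph}
    (hB : IsCopy H B) : B.edgeSet.ncard = H.edgeSet.ncard := by
  obtain ⟨f⟩ := hB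
  rw [← Set.ncard_congr' f.mapEdgeSet, ← B.image_coe_edgeSet_coe,
    Set.ncard_image_of_injective _ (Sym2.map.injective Subtype.val_injective)]

lemma copy_verts {n v : ℕ} {H : SimpleGraph (Fin v)} {B : (⊤ : SimpleGraph (Fin n)).Subgraph}
    (hB : IsCopy H B) : B.verts.ncard = v := by
  obtain ⟨f⟩ := hB
  rw [← Nat.card_coe_set_eq, Nat.card_congr f.toEquiv]; simp

lemma copy_eq {n v : ℕ} {H : SimpleGraph (Fin v)} {B C : (⊤ : SimpleGraph (Fin n)).Subgraph}
    (hB : IsCopy H B) (hC : IsCopy H C) (h : B ≤ C) : B = C := by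
  have h1 : B.verts = C.verts := Set.eq_of_subset_of_ncard_le h.1
    (by rw [copy_verts hB, copy_verts hC])
  have h2 : B.edgeSet = C.edgeSet := Set.eq_of_subset_of_ncard_le
    (SimpleGraph.Subgraph.edgeSet_mono h) (by rw [copy_ncard hB, copy_ncard hC])
  ext a b
  · rw [h1]
  · rw [← SimpleGraph.Subgraph.mem_edgeSet, h2, SimpleGraph.Subgraph.mem_edgeSet]

/-- Homomorphism of the complete graph given by a permutation. -/
def permHom {n : ℕ} (σ : Equiv.Perm (Fin n)) :
    (⊤ : SimpleGraph (Fin n)) →g (⊤ : SimpleGraph (Fin n)) where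
  toFun := σ
  map_rel' := by intro a b h; simpa using h

lemma map_edges {n : ℕ} (σ : Equiv.Perm (Fin n)) (B : (⊤ : SimpleGraph (Fin n)).Subgraph) :
    (B.map (permHom σ)).edgeSet = Sym2.map σ '' B.edgeSet :=
  SimpleGraph.Subgraph.edgeSet_map _ _

lemma map_symm {n : ℕ} (σ : Equiv.Perm (Fin n)) (B : (⊤ : SimpleGraph (Fin n)).Subgraph) :
    (B.map (permHom σ)).map (permHom σ.symm) = B := by
  rw [← SimpleGraph.Subgraph.map_comp]
  convert B.map_id
  ext a
  simp [permHom]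

lemma map_copy {n v : ℕ} {H : SimpleGraph (Fin v)} (σ : Equiv.Perm (Fin n))
    {B : (⊤ : SimpleGraph (Fin n)).Subgraph} (hB : IsCopy H B) :
    IsCopy H (B.map (permHom σ)) := by
  obtain ⟨f⟩ := hB
  have g : B.coe ≃g (B.map (permHom σ)).coe :=
    { toEquiv := σ.image B.verts
      map_rel_iff' := by
        rintro ⟨a, ha⟩ ⟨b, hb⟩
        simp only [SimpleGraph.Subgraph.coe_adj]
        change Relation.Map B.Adj σ σ (σ a) (σ b) ↔ _
        simp [Relation.Map] }
  exact ⟨g.symm.trans f⟩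

lemma copy_perm {n v : ℕ} {H : SimpleGraph (Fin v)} {A B : (⊤ : SimpleGraph (Fin n)).Subgraph}
    (hA : IsCopy H A) (hB : IsCopy H B) : ∃ σ : Equiv.Perm (Fin n), A.map (permHom σ) = B := by
  classical
  obtain ⟨f⟩ := hA
  obtain ⟨g⟩ := hB
  have k : A.coe ≃g B.coe := f.trans g.symm
  let σ : Equiv.Perm (Fin n) := Equiv.extendSubtype (p := (· ∈ A.verts)) (q := (· ∈ B.verts)) k.toEquiv
  have hσ : ∀ x (hx : x ∈ A.verts), σ x = k ⟨x, hx⟩ := fun x hx =>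
    Equiv.extendSubtype_apply_of_mem (p := (· ∈ A.verts)) (q := (· ∈ B.verts)) k.toEquiv x hx
  refine ⟨σ, copy_eq (H := H) (map_copy σ ⟨f⟩) ⟨g⟩ ⟨?_, ?_⟩⟩
  · rintro _ ⟨x, hx, rfl⟩
    change σ x ∈ _
    rw [hσ x hx]; exact (k ⟨x, hx⟩).2
  · rintro _ _ ⟨x, y, hxy, rfl, rfl⟩
    change B.Adj (σ x) (σ y)
    rw [hσ x hxy.fst_mem, hσ y hxy.snd_mem]
    have : A.coe.Adj ⟨x, hxy.fst_mem⟩ ⟨y, hxy.snd_mem⟩ := hxy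
    exact k.map_rel_iff.2 this

lemma sum_invariant {n v : ℕ} {H : SimpleGraph (Fin v)} {A B : (⊤ : SimpleGraph (Fin n)).Subgraph}
    (hA : IsCopy H A) (hB : IsCopy H B) (T : Finset (⊤ : SimpleGraph (Fin n)).Subgraph)
    (hT : ∀ C, C ∈ T ↔ IsCopy H C) (f : ℕ → ℝ) :
    ∑ C ∈ T, f (B.edgeSet ∪ C.edgeSet).ncard = ∑ C ∈ T, f (A.edgeSet ∪ C.edgeSet).ncard := by
  obtain ⟨σ, rfl⟩ := copy_perm hA hB
  symm
  refine Finset.sum_bij' (fun C _ => C.map (permHom σ)) (fun C _ => C.map (permHom σ.symm))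
    ?_ ?_ ?_ ?_ ?_
  · intro C hC; rw [hT] at *; exact map_copy _ hC
  · intro C hC; rw [hT] at *; exact map_copy _ hC
  · intro C hC; exact map_symm _ _
  · intro C hC; exact map_symm σ.symm _
  · intro C hC
    rw [map_edges, map_edges, ← Set.image_union,
      Set.ncard_image_of_injective _ (Sym2.map.injective σ.injective)]

lemma er_moments (n : ℕ) (p : ℝ) [hp : Fact (0 < p ∧ p < 1)]
    {v : ℕ} (H : SimpleGraph (Fin v)) (T : Finset (⊤ : SimpleGraph (Fin n)).Subgraph)
    (hT : ∀ C, C ∈ T ↔ IsCopy H C) :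
    (∫ ω, (numCopies H (erGraph ω) : ℝ) ∂erMeasure n p = ∑ B ∈ T, p ^ B.edgeSet.ncard) ∧
    (∫ ω, (numCopies H (erGraph ω) : ℝ) ^ 2 ∂erMeasure n p =
      ∑ B ∈ T, ∑ C ∈ T, p ^ (B.edgeSet ∪ C.edgeSet).ncard) := by
  classical
  have := er_prob n p
  have h1 : ∀ ω : EdgeSpace n, (numCopies H (erGraph ω) : ℝ) =
      ∑ B ∈ T, Set.indicator {ω : EdgeSpace n | B.edgeSet ⊆ (erGraph ω).edgeSet} 1 ω := by
    intro ω
    have : {B : (⊤ : SimpleGraph (Fin n)).Subgraph | IsCopy H B ∧ B.edgeSet ⊆ (erGraph ω).edgeSet}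
        = ↑(T.filter fun B => B.edgeSet ⊆ (erGraph ω).edgeSet) := by
      ext B; simp [hT]
    rw [numCopies, this, Set.ncard_coe_finset]
    simp [Set.indicator_apply, Finset.sum_boole]
  have h2 : ∀ S : Set (Sym2 (Fin n)), (∀ e ∈ S, ¬ e.IsDiag) →
      ∫ ω, Set.indicator {ω : EdgeSpace n | S ⊆ (erGraph ω).edgeSet} (1 : EdgeSpace n → ℝ) ω
        ∂erMeasure n p = p ^ S.ncard := by
    intro S hS
    rw [integral_indicator_one (MeasurableSet.of_discrete), er_present n p S hS]
  constructor
  · simp_rw [h1]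
    rw [integral_finsetSum _ (fun _ _ => Integrable.of_finite)]
    exact Finset.sum_congr rfl fun B _ => h2 _ (subg_nd B)
  · simp_rw [h1, sq, Finset.sum_mul_sum]
    rw [integral_finsetSum _ (fun _ _ => Integrable.of_finite)]
    refine Finset.sum_congr rfl fun B _ => ?_
    rw [integral_finsetSum _ (fun _ _ => Integrable.of_finite)]
    refine Finset.sum_congr rfl fun C _ => ?_
    rw [← h2 _ (fun e he => he.elim (subg_nd B e) (subg_nd C e))]
    congr 1
    ext ω
    simp only [Set.indicator_apply, Set.mem_ofPred_eq, Set.union_subset_iff, Pi.one_apply]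
    split_ifs <;> simp_all

/-- A bound for `Var(W) − λ + 2 λ p^{e_H}` in terms of the sets
`Γ^{H',α}` of copies of `H` whose intersection with a fixed copy `α` of `H` is `H'`. -/
theorem variance_bound_subgraph_count
    (n : ℕ) (p : ℝ) (hp : 0 < p ∧ p < 1)
    (v : ℕ) (H : SimpleGraph (Fin v))
    (hv : 0 < v ∧ v ≤ n)
    (he : H.edgeSet.Nonempty)
    (hnoiso : ∀ x, ∃ y, H.Adj x y)
    -- a fixed copy `α` of `H` in `K_n`
    (A : (⊤ : SimpleGraph (Fin n)).Subgraph) (hA : IsCopy H A)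
    (W : EdgeSpace n → ℕ) (hW : ∀ ω, W ω = numCopies H (erGraph ω))
    (lam : ℝ) (hlam : lam = ∫ ω, (W ω : ℝ) ∂erMeasure n p) :
    variance (fun ω => (W ω : ℝ)) (erMeasure n p) - lam + 2 * lam * p ^ H.edgeSet.ncard
      ≤ lam * (p ^ H.edgeSet.ncard
          + ∑ᶠ B ∈ {B : (⊤ : SimpleGraph (Fin n)).Subgraph |
                B ≤ A ∧ B ≠ A ∧ B.edgeSet.Nonempty},
              (Set.ncard {C : (⊤ : SimpleGraph (Fin n)).Subgraph |
                  IsCopy H C ∧ C ⊓ A = B} : ℝ)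
                * p ^ (H.edgeSet.ncard - B.edgeSet.ncard)) := by
  classical
  have : Fact (0 < p ∧ p < 1) := ⟨hp⟩
  have := er_prob n p
  have hp0 := hp.1
  have hTf := Set.toFinite {C : (⊤ : SimpleGraph (Fin n)).Subgraph | IsCopy H C}
  set T := hTf.toFinset with hTdef
  have hT : ∀ C, C ∈ T ↔ IsCopy H C := by intro C; simp [hTdef]
  obtain ⟨m1, m2⟩ := er_moments n p H T hT
  set m := H.edgeSet.ncard with hm
  have hl : lam = T.card * p ^ m := by
    rw [hlam]; simp_rw [hW]; rw [m1, Finset.sum_congr rfl (g := fun _ => p ^ m)]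
    · simp
    · intro B hB; rw [copy_ncard ((hT B).1 hB)]
  have hV : variance (fun ω => (W ω : ℝ)) (erMeasure n p) =
      T.card * (∑ C ∈ T, p ^ (A.edgeSet ∪ C.edgeSet).ncard) - lam ^ 2 := by
    rw [variance_eq_sub MemLp.of_discrete, ← hlam]
    congr 1
    simp only [Pi.pow_apply]
    simp_rw [hW]; rw [m2, Finset.sum_congr rfl
      (fun B hB => sum_invariant hA ((hT B).1 hB) T hT (fun k => p ^ k))]
    simp
  have hun : ∀ C ∈ T, p ^ (A.edgeSet ∪ C.edgeSet).ncard =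
      p ^ m * p ^ (m - (C ⊓ A).edgeSet.ncard) := by
    intro C hC
    have h1 := Set.ncard_union_add_ncard_inter A.edgeSet C.edgeSet
    have h2 : (C ⊓ A).edgeSet.ncard ≤ m := by
      rw [hm, ← copy_ncard hA]
      exact Set.ncard_le_ncard (SimpleGraph.Subgraph.edgeSet_mono inf_le_right)
    rw [SimpleGraph.Subgraph.edgeSet_inf, Set.inter_comm] at h2 ⊢
    rw [copy_ncard hA, copy_ncard ((hT C).1 hC), ← hm] at h1
    rw [← pow_add]
    congr 1
    omega
  rw [Finset.sum_congr rfl hun, ← Finset.mul_sum] at hV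
  have hAT := (hT A).2 hA
  set F := (Set.toFinite {B : (⊤ : SimpleGraph (Fin n)).Subgraph |
                B ≤ A ∧ B ≠ A ∧ B.edgeSet.Nonempty}).toFinset with hF
  have hfs : (∑ᶠ B ∈ {B : (⊤ : SimpleGraph (Fin n)).Subgraph |
                B ≤ A ∧ B ≠ A ∧ B.edgeSet.Nonempty},
              (Set.ncard {C : (⊤ : SimpleGraph (Fin n)).Subgraph |
                  IsCopy H C ∧ C ⊓ A = B} : ℝ)
                * p ^ (m - B.edgeSet.ncard)) =
      ∑ C ∈ T with C ⊓ A ∈ F, p ^ (m - (C ⊓ A).edgeSet.ncard) := by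
    rw [finsum_mem_eq_finite_toFinset_sum _ (Set.toFinite _), ← hF]
    rw [← Finset.sum_fiberwise_of_maps_to (s := T.filter (fun C => C ⊓ A ∈ F)) (t := F)
      (g := fun C => C ⊓ A) (fun C hC => (Finset.mem_filter.1 hC).2)]
    refine Finset.sum_congr rfl fun B hB => ?_
    have : {C : (⊤ : SimpleGraph (Fin n)).Subgraph | IsCopy H C ∧ C ⊓ A = B} =
        ↑((T.filter (fun C => C ⊓ A ∈ F)).filter (fun C => C ⊓ A = B)) := by
      ext C
      simp only [Set.mem_ofPred_eq, Finset.coe_filter, Finset.mem_filter, hT]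
      constructor
      · rintro ⟨h1, rfl⟩; exact ⟨⟨h1, hB⟩, rfl⟩
      · rintro ⟨⟨h1, _⟩, h2⟩; exact ⟨h1, h2⟩
    rw [this, Set.ncard_coe_finset, ← nsmul_eq_mul, ← Finset.sum_const]
    refine Finset.sum_congr rfl fun C hC => ?_
    rw [(Finset.mem_filter.1 hC).2]
  rw [hfs]
  -- main inequality
  have key : ∑ C ∈ T, (p ^ (m - (C ⊓ A).edgeSet.ncard) - p ^ m) ≤
      (1 - p ^ m) + ∑ C ∈ T with C ⊓ A ∈ F, p ^ (m - (C ⊓ A).edgeSet.ncard) := by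
    rw [Finset.sum_filter, ← Finset.add_sum_erase _ _ hAT, ← Finset.add_sum_erase T
      (fun C => if C ⊓ A ∈ F then p ^ (m - (C ⊓ A).edgeSet.ncard) else 0) hAT]
    have e1 : A ⊓ A ∉ F := by simp [hF]
    simp only [if_neg e1, zero_add]
    refine add_le_add ?_ (Finset.sum_le_sum fun C hC => ?_)
    · rw [inf_idem, copy_ncard hA]; simp [hm]
    · have hCA := (Finset.mem_erase.1 hC).1
      have hCc := (hT C).1 (Finset.mem_erase.1 hC).2
      split_ifs with h
      · have := pow_pos hp0 m; linarith
      · have : ¬ (C ⊓ A).edgeSet.Nonempty := by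
          intro hne
          apply h
          simp only [hF, Set.Finite.mem_toFinset, Set.mem_ofPred_eq]
          refine ⟨inf_le_right, fun h => ?_, hne⟩
          exact hCA (copy_eq hA hCc (inf_eq_right.1 h)).symm
        rw [Set.not_nonempty_iff_eq_empty] at this
        simp [this]
  rw [Finset.sum_sub_distrib, Finset.sum_const, nsmul_eq_mul] at key
  have hl0 : 0 ≤ lam := by rw [hl]; positivity
  rw [hV]
  have := mul_le_mul_of_nonneg_left key hl0
  have e : (T.card : ℝ) * (p ^ m * ∑ C ∈ T, p ^ (m - (C ⊓ A).edgeSet.ncard)) =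
      lam * ∑ C ∈ T, p ^ (m - (C ⊓ A).edgeSet.ncard) := by rw [hl]; ring
  rw [e]
  rw [← hl] at this
  linarith
end

section
/- Let d ≥ 2 and let H_1, ..., H_d be distinct cycles of lengths k_1 < k_2 < ... < k_d with k_1 ≥ 3. Fix c > 0 and let p = p(n) = c n^{-1}(1 + o(1)). Let W_i be the number of copies of the cycle H_i in G(n,p), so that E(W_i) = [n(n−1)···(n−k_i+1) / (2k_i)] p^{k_i} and λ_i = E(W_i) → c^{k_i}/(2k_i) as n → ∞. Then there exists a constant C > 0 such that for all sufficiently large n, d_W((W_1, ..., W_d), P_λ) ≤ C n^{-1}, where P_λ has independent Poisson components with means λ_1, ..., λ_d. -/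
open MeasureTheory ProbabilityTheory Filter
open scoped ENNReal NNReal

/-- `g : ℕ^d → ℝ` is Lipschitz with constant at most `1` with respect to the `1`-norm. -/
def Lip1 (d : ℕ) (g : (Fin d → ℕ) → ℝ) : Prop :=
  ∀ x y : Fin d → ℕ, |g x - g y| ≤ ∑ i, |(x i : ℝ) - (y i : ℝ)|

/-- The Wasserstein distance between two laws on `ℕ^d`:
`d_W(μ, ν) = sup { |∫ g dμ - ∫ g dν| : g ∈ Lip^d(1) }`. -/
noncomputable def distW {d : ℕ} (μ ν : Measure (Fin d → ℕ)) : ℝ≥0∞ :=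
  ⨆ g ∈ {g | Lip1 d g}, ENNReal.ofReal |(∫ x, g x ∂μ) - ∫ x, g x ∂ν|

/-- The law of a random vector with independent Poisson components of means `lam i`. -/
noncomputable def poissonPi {d : ℕ} (lam : Fin d → ℝ) : Measure (Fin d → ℕ) :=
  Measure.pi fun i => ProbabilityTheory.poissonMeasure (lam i).toNNReal


open MeasureTheory ProbabilityTheory Filter
open scoped ENNReal NNReal

theorem map_update_pi {ι : Type*} [Fintype ι] [DecidableEq ι] {X : ι → Type*}
    [∀ i, MeasurableSpace (X i)] (μ : ∀ i, Measure (X i)) [∀ i, IsProbabilityMeasure (μ i)]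
    (i : ι) :
    Measure.map (fun q : (∀ i, X i) × X i => Function.update q.1 i q.2)
      ((Measure.pi μ).prod (μ i)) = Measure.pi μ := by
  symm
  apply Measure.pi_eq
  intro s hs
  have hm : Measurable (fun q : (∀ i, X i) × X i => Function.update q.1 i q.2) := by
    rw [measurable_pi_iff]
    intro j
    by_cases h : j = i
    · subst h
      simpa using measurable_snd
    · simp only [Function.update_of_ne h]
      exact (measurable_pi_apply j).comp measurable_fst
  rw [Measure.map_apply hm (MeasurableSet.univ_pi hs)]
  have : (fun q : (∀ i, X i) × X i => Function.update q.1 i q.2) ⁻¹' (Set.univ.pi s)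
      = (Set.univ.pi (Function.update s i Set.univ)) ×ˢ (s i) := by
    ext q
    simp only [Set.mem_preimage, Set.mem_pi, Set.mem_univ, true_imp_iff, Set.mem_prod]
    constructor
    · intro h
      refine ⟨fun j => ?_, by simpa using h i⟩
      by_cases hj : j = i
      · subst hj; simp
      · simpa [Function.update_of_ne hj] using h j
    · rintro ⟨h, h2⟩ j
      by_cases hj : j = i
      · subst hj; simpa using h2
      · simpa [Function.update_of_ne hj] using h j
  rw [this, Measure.prod_prod, Measure.pi_pi]
  rw [← Finset.mul_prod_erase _ _ (Finset.mem_univ i)]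
  rw [← Finset.mul_prod_erase _ (fun i => μ i (s i)) (Finset.mem_univ i)]
  simp only [Function.update_self, measure_univ, one_mul]
  rw [mul_comm]
  congr 1
  apply Finset.prod_congr rfl
  intro j hj
  rw [Function.update_of_ne (Finset.ne_of_mem_erase hj)]

theorem measurable_update_pair {ι : Type*} [DecidableEq ι] {X : ι → Type*}
    [∀ i, MeasurableSpace (X i)] (i : ι) :
    Measurable (fun q : (∀ i, X i) × X i => Function.update q.1 i q.2) := by
  rw [measurable_pi_iff]
  intro j
  by_cases h : j = i
  · subst h
    simpa using measurable_snd
  · simp only [Function.update_of_ne h]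
    exact (measurable_pi_apply j).comp measurable_fst

theorem integral_resample {ι : Type*} [Fintype ι] [DecidableEq ι] {X : ι → Type*}
    [∀ i, MeasurableSpace (X i)] (μ : ∀ i, Measure (X i)) [∀ i, IsProbabilityMeasure (μ i)]
    (i : ι) (F : (∀ i, X i) → ℝ) (hF : Integrable F (Measure.pi μ)) :
    ∫ x, F x ∂(Measure.pi μ) =
      ∫ x, ∫ b, F (Function.update x i b) ∂(μ i) ∂(Measure.pi μ) := by
  have hF' := hF
  rw [← map_update_pi μ i] at hF'
  have h1 := (integrable_map_measure hF'.1 (measurable_update_pair i).aemeasurable).1 hF'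
  conv_lhs => rw [← map_update_pi μ i]
  rw [integral_map (measurable_update_pair i).aemeasurable hF'.1]
  exact integral_prod _ h1

theorem bernoulliB_prob {p : ℝ} (h0 : 0 ≤ p) (h1 : p ≤ 1) :
    IsProbabilityMeasure (bernoulliB p) := by
  constructor
  simp only [bernoulliB, Measure.add_apply, Measure.smul_apply, smul_eq_mul, measure_univ, mul_one]
  rw [← ENNReal.ofReal_add h0 (by linarith)]
  simp

theorem integral_bernoulliB {p : ℝ} (h0 : 0 ≤ p) (h1 : p ≤ 1) (F : Bool → ℝ) :
    ∫ b, F b ∂(bernoulliB p) = p * F true + (1 - p) * F false := by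
  unfold bernoulliB
  have i1 : IsFiniteMeasure (ENNReal.ofReal p • Measure.dirac true) :=
    ⟨by simp⟩
  have i2 : IsFiniteMeasure (ENNReal.ofReal (1 - p) • Measure.dirac false) :=
    ⟨by simp⟩
  rw [integral_add_measure Integrable.of_finite Integrable.of_finite,
    integral_smul_measure, integral_smul_measure]
  simp [ENNReal.toReal_ofReal h0, ENNReal.toReal_ofReal (by linarith : (0:ℝ) ≤ 1 - p)]

/-- Force all coordinates in `S` to be true. -/
def force {ι : Type*} [DecidableEq ι] (S : Finset ι) (ω : ι → Bool) : ι → Bool :=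
  fun e => if e ∈ S then true else ω e

/-- Indicator that all coordinates in `S` are true. -/
noncomputable def ind {ι : Type*} (S : Finset ι) (ω : ι → Bool) : ℝ :=
  open Classical in if ∀ e ∈ S, ω e = true then 1 else 0

theorem ind_nonneg {ι : Type*} (S : Finset ι) (ω : ι → Bool) : 0 ≤ ind S ω := by
  unfold ind; split_ifs <;> norm_num

theorem ind_le_one {ι : Type*} (S : Finset ι) (ω : ι → Bool) : ind S ω ≤ 1 := by
  unfold ind; split_ifs <;> norm_num

theorem integral_ind_mul {ι : Type*} [Fintype ι] [DecidableEq ι] {p : ℝ} (h0 : 0 ≤ p)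
    (h1 : p ≤ 1) (S : Finset ι) (F : (ι → Bool) → ℝ) :
    ∫ ω, ind S ω * F ω ∂(Measure.pi fun _ : ι => bernoulliB p)
      = p ^ S.card * ∫ ω, F (force S ω) ∂(Measure.pi fun _ : ι => bernoulliB p) := by
  have := bernoulliB_prob h0 h1
  induction S using Finset.induction_on generalizing F with
  | empty =>
    have h : ∀ ω : ι → Bool, force ∅ ω = ω := fun ω => by ext; simp [force]
    simp [ind, h]
  | insert e S he ih =>
    have e1 : ∀ ω : ι → Bool, ind (insert e S) ω * F ω
        = ind S ω * ((if ω e = true then 1 else 0) * F ω) := by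
      intro ω
      unfold ind
      by_cases h : ω e = true <;> simp [h]
    simp_rw [e1]
    rw [ih, Finset.card_insert_of_notMem he, pow_succ, mul_assoc]
    congr 1
    rw [integral_resample _ e _ Integrable.of_finite]
    simp_rw [integral_bernoulliB h0 h1]
    rw [← integral_const_mul]
    apply integral_congr_ae
    filter_upwards with ω
    have h3 : force S (Function.update ω e true) = force (insert e S) ω := by
      ext x
      by_cases hx : x = e
      · subst hx; simp [force]
      · simp [force, hx]
    simp only [h3]
    simp [force, he]

theorem integral_ind {ι : Type*} [Fintype ι] [DecidableEq ι] {p : ℝ} (h0 : 0 ≤ p)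
    (h1 : p ≤ 1) (S : Finset ι)  :
    ∫ ω, ind S ω ∂(Measure.pi fun _ : ι => bernoulliB p) = p ^ S.card := by
  have := bernoulliB_prob h0 h1
  have h := integral_ind_mul h0 h1 S (fun _ => 1)
  simpa using h

theorem ind_force {ι : Type*} [DecidableEq ι] (S T : Finset ι) (ω : ι → Bool) :
    ind T (force S ω) = ind (T \ S) ω := by
  unfold ind force
  congr 1
  simp only [Finset.mem_sdiff, eq_iff_iff]
  grind

/-- Solution of the Stein equation. -/
noncomputable def steinF (l : ℝ) (G : ℕ → ℝ) (x : ℕ) : ℝ :=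
  - ∑' m : ℕ, l ^ m * ((x - 1).factorial : ℝ) / ((x + m).factorial : ℝ) * G (x + m)

theorem stein_term_bound {l : ℝ} (hl : 0 ≤ l) {G : ℕ → ℝ} {B : ℝ} (hB : 0 ≤ B)
    (hG : ∀ j, 1 ≤ j → |G j| ≤ B * j) (x : ℕ) (hx : 1 ≤ x) (m : ℕ) :
    |l ^ m * ((x - 1).factorial : ℝ) / ((x + m).factorial : ℝ) * G (x + m)|
      ≤ B * (l ^ m / m.factorial) := by
  obtain ⟨y, rfl⟩ : ∃ y, x = y + 1 := ⟨x - 1, by omega⟩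
  rw [abs_mul, abs_of_nonneg (by positivity)]
  have h1 := hG (y + 1 + m) (by omega)
  have h2 : ((y + 1 + m).factorial : ℝ) = (y + 1 + m : ℕ) * (y + m).factorial := by
    rw [show y + 1 + m = (y + m) + 1 by ring, Nat.factorial_succ]
    push_cast; ring
  have h3 : ((y.factorial : ℝ)) * m.factorial ≤ (y + m).factorial := by
    exact_mod_cast Nat.le_of_dvd (Nat.factorial_pos _) (Nat.factorial_mul_factorial_dvd_factorial_add y m)
  have h4 : (0:ℝ) < (y + 1 + m : ℕ) := by positivity
  calc _ ≤ l ^ m * ((y + 1 - 1).factorial : ℝ) / ((y + 1 + m).factorial : ℝ) * (B * (y + 1 + m : ℕ)) := by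
        gcongr
    _ = B * (l ^ m * ((y.factorial : ℝ) / (y + m).factorial)) := by
        rw [h2, Nat.add_sub_cancel]
        field_simp
    _ ≤ B * (l ^ m * (1 / m.factorial)) := by
        have : (y.factorial : ℝ) / (y + m).factorial ≤ 1 / m.factorial := by
          rw [div_le_div_iff₀ (by positivity) (by positivity)]
          linarith
        exact mul_le_mul_of_nonneg_left (mul_le_mul_of_nonneg_left this (by positivity)) hB
    _ = _ := by ring

theorem stein_summable {l : ℝ} (hl : 0 ≤ l) {G : ℕ → ℝ} {B : ℝ} (hB : 0 ≤ B)
    (hG : ∀ j, 1 ≤ j → |G j| ≤ B * j) (x : ℕ) (hx : 1 ≤ x) :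
    Summable (fun m : ℕ => l ^ m * ((x - 1).factorial : ℝ) / ((x + m).factorial : ℝ) * G (x + m)) := by
  apply Summable.of_norm_bounded (g := fun m : ℕ => B * (l ^ m / m.factorial))
  · exact (Real.summable_pow_div_factorial l).mul_left B
  · intro m
    exact stein_term_bound hl hB hG x hx m

theorem steinF_bound {l : ℝ} (hl : 0 ≤ l) {G : ℕ → ℝ} {B : ℝ} (hB : 0 ≤ B)
    (hG : ∀ j, 1 ≤ j → |G j| ≤ B * j) (x : ℕ) (hx : 1 ≤ x) :
    |steinF l G x| ≤ B * Real.exp l := by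
  unfold steinF
  rw [abs_neg, Real.exp_eq_exp_ℝ, NormedSpace.exp_eq_tsum_div, ← tsum_mul_left]
  apply tsum_of_norm_bounded (f := fun m : ℕ => l ^ m * ((x - 1).factorial : ℝ) / ((x + m).factorial : ℝ) * G (x + m))
  · exact ((Real.summable_pow_div_factorial l).mul_left B).hasSum
  · intro m
    exact stein_term_bound hl hB hG x hx m

theorem steinF_sub {l : ℝ} (hl : 0 ≤ l) {G G' : ℕ → ℝ} {B : ℝ} (hB : 0 ≤ B)
    (hG : ∀ j, 1 ≤ j → |G j| ≤ B * j) (hG' : ∀ j, 1 ≤ j → |G' j| ≤ B * j) (x : ℕ) (hx : 1 ≤ x) :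
    steinF l G x - steinF l G' x = steinF l (fun j => G j - G' j) x := by
  unfold steinF
  simp_rw [mul_sub]
  rw [(stein_summable hl hB hG x hx).tsum_sub (stein_summable hl hB hG' x hx)]
  ring

theorem steinF_eq {l : ℝ} (hl : 0 ≤ l) {G : ℕ → ℝ} {B : ℝ} (hB : 0 ≤ B)
    (hG : ∀ j, 1 ≤ j → |G j| ≤ B * j) (h0 : HasSum (fun j : ℕ => l ^ j / j.factorial * G j) 0)
    (x : ℕ) : l * steinF l G (x + 1) - x * steinF l G x = G x := by
  have key : ∀ y : ℕ, l * ∑' m : ℕ, l ^ m * (y.factorial : ℝ) / ((y + 1 + m).factorial : ℝ) * G (y + 1 + m)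
      = ∑' m : ℕ, l ^ (m+1) * (y.factorial : ℝ) / ((y + (m + 1)).factorial : ℝ) * G (y + (m + 1)) := by
    intro y
    rw [← tsum_mul_left]
    apply tsum_congr
    intro m
    rw [show y + 1 + m = y + (m + 1) by ring]
    ring
  unfold steinF
  rw [Nat.add_sub_cancel]
  rcases Nat.eq_zero_or_pos x with rfl | hx
  · have h2 := h0.summable.tsum_eq_zero_add
    rw [h0.tsum_eq] at h2
    have := key 0
    simp at this h2 ⊢
    rw [this]
    linarith
  · have hs := stein_summable hl hB hG x hx
    have h2 : ∑' m : ℕ, l ^ m * (x.factorial : ℝ) / ((x + m).factorial : ℝ) * G (x + m)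
      = x * ∑' m : ℕ, l ^ m * ((x-1).factorial : ℝ) / ((x + m).factorial : ℝ) * G (x + m) := by
      rw [← tsum_mul_left]
      apply tsum_congr
      intro m
      rw [← Nat.mul_factorial_pred (by omega : x ≠ 0)]
      push_cast; ring
    have hs' : Summable (fun m : ℕ => l ^ m * (x.factorial : ℝ) / ((x + m).factorial : ℝ) * G (x + m)) := by
      have := hs.mul_left (x:ℝ)
      refine this.congr fun m => ?_
      rw [← Nat.mul_factorial_pred (by omega : x ≠ 0)]
      push_cast; ring
    have h3 := hs'.tsum_eq_zero_add
    rw [mul_neg, key x, mul_neg, ← h2, h3]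
    have : (x.factorial : ℝ) ≠ 0 := by positivity
    simp [this]

open MeasureTheory ProbabilityTheory Filter
open scoped ENNReal NNReal

theorem poisson_mean_hasSum (r : ℝ≥0) :
    HasSum (fun n : ℕ => Real.exp (-r) * (r:ℝ) ^ n / (n.factorial : ℝ) * (n:ℝ)) r := by
  rw [← hasSum_nat_add_iff' 1]
  have h := (hasSum_one_poissonMeasure r).mul_left (r:ℝ)
  simp only [Finset.sum_range_one, Nat.cast_zero, mul_zero, sub_zero]
  rw [mul_one] at h
  refine h.congr_fun ?_ 
  intro n
  rw [Nat.factorial_succ]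
  push_cast
  field_simp
  ring

theorem poisson_integrable_nat (r : ℝ≥0) :
    Integrable (fun n : ℕ => (n:ℝ)) (poissonMeasure r) := by
  rw [integrable_poissonMeasure_iff]
  simpa using (poisson_mean_hasSum r).summable

theorem poisson_mean (r : ℝ≥0) : ∫ n : ℕ, (n:ℝ) ∂(poissonMeasure r) = r := by
  rw [integral_poissonMeasure]
  simpa using (poisson_mean_hasSum r).tsum_eq

theorem poisson_integrable_of_growth (r : ℝ≥0) (f : ℕ → ℝ) (A : ℝ)
    (h : ∀ j, |f j| ≤ A + j) : Integrable f (poissonMeasure r) := by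
  refine Integrable.mono' ((integrable_const A).add (poisson_integrable_nat r)) .of_discrete ?_
  filter_upwards with j
  simpa using h j

/-- Average over coordinate `i` against a Poisson law. -/
noncomputable def avgT {d : ℕ} (r : ℝ≥0) (i : Fin d) (g : (Fin d → ℕ) → ℝ) (x : Fin d → ℕ) : ℝ :=
  ∫ N, g (Function.update x i N) ∂(poissonMeasure r)

theorem lip_update {d : ℕ} {g : (Fin d → ℕ) → ℝ} (hg : Lip1 d g) (x : Fin d → ℕ) (i : Fin d)
    (a b : ℕ) : |g (Function.update x i a) - g (Function.update x i b)| ≤ |(a:ℝ) - b| := by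
  refine (hg _ _).trans ?_
  rw [← Finset.add_sum_erase _ _ (Finset.mem_univ i)]
  rw [Finset.sum_eq_zero]
  · simp
  · intro j hj
    simp [Function.update_of_ne (Finset.ne_of_mem_erase hj)]

theorem lip_update' {d : ℕ} {g : (Fin d → ℕ) → ℝ} (hg : Lip1 d g) (x y : Fin d → ℕ) (i : Fin d)
    (a : ℕ) : |g (Function.update x i a) - g (Function.update y i a)|
      ≤ ∑ j ∈ Finset.univ.erase i, |(x j:ℝ) - y j| := by
  refine (hg _ _).trans ?_
  rw [← Finset.add_sum_erase _ _ (Finset.mem_univ i)]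
  simp only [Function.update_self, sub_self, abs_zero, zero_add]
  apply Finset.sum_le_sum
  intro j hj
  simp [Function.update_of_ne (Finset.ne_of_mem_erase hj)]

theorem lip_integrable_update {d : ℕ} {g : (Fin d → ℕ) → ℝ} (hg : Lip1 d g) (r : ℝ≥0)
    (x : Fin d → ℕ) (i : Fin d) :
    Integrable (fun N => g (Function.update x i N)) (poissonMeasure r) := by
  apply poisson_integrable_of_growth r _ |g (Function.update x i 0)|
  intro j
  have h := lip_update hg x i j 0
  have h2 := abs_sub_abs_le_abs_sub (g (Function.update x i j)) (g (Function.update x i 0))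
  simp at h
  linarith

theorem avgT_sub_le {d : ℕ} {g : (Fin d → ℕ) → ℝ} (hg : Lip1 d g) (r : ℝ≥0)
    (x y : Fin d → ℕ) (i : Fin d) :
    |avgT r i g x - avgT r i g y| ≤ ∑ j ∈ Finset.univ.erase i, |(x j:ℝ) - y j| := by
  unfold avgT
  rw [← integral_sub (lip_integrable_update hg r x i) (lip_integrable_update hg r y i)]
  have := norm_integral_le_of_norm_le_const (μ := poissonMeasure r)
    (f := fun N => g (Function.update x i N) - g (Function.update y i N))
    (C := ∑ j ∈ Finset.univ.erase i, |(x j:ℝ) - y j|)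
    (by filter_upwards with N; exact lip_update' hg x y i N)
  simpa using this

theorem avgT_lip {d : ℕ} {g : (Fin d → ℕ) → ℝ} (hg : Lip1 d g) (r : ℝ≥0) (i : Fin d) :
    Lip1 d (avgT r i g) := by
  intro x y
  refine (avgT_sub_le hg r x y i).trans ?_
  exact Finset.sum_le_sum_of_subset_of_nonneg (Finset.subset_univ _) (fun _ _ _ => abs_nonneg _)

theorem avgT_update {d : ℕ} (g : (Fin d → ℕ) → ℝ) (r : ℝ≥0) (i : Fin d) (x : Fin d → ℕ) (b : ℕ) :
    avgT r i g (Function.update x i b) = avgT r i g x := by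
  unfold avgT; simp

/-- The centred slice. -/
noncomputable def slice {d : ℕ} (r : ℝ≥0) (i : Fin d) (g : (Fin d → ℕ) → ℝ) (x : Fin d → ℕ)
    (j : ℕ) : ℝ := g (Function.update x i j) - avgT r i g x

theorem slice_bound {d : ℕ} {g : (Fin d → ℕ) → ℝ} (hg : Lip1 d g) (r : ℝ≥0) (i : Fin d)
    (x : Fin d → ℕ) (j : ℕ) (hj : 1 ≤ j) : |slice r i g x j| ≤ (1 + r) * j := by
  unfold slice avgT
  have h1 : g (Function.update x i j) - ∫ N, g (Function.update x i N) ∂(poissonMeasure r)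
      = ∫ N, (g (Function.update x i j) - g (Function.update x i N)) ∂(poissonMeasure r) := by
    rw [integral_sub (integrable_const _) (lip_integrable_update hg r x i)]
    simp
  rw [h1]
  have h2 : ‖∫ N, (g (Function.update x i j) - g (Function.update x i N)) ∂(poissonMeasure r)‖
     ≤ ∫ N : ℕ, ((j:ℝ) + N) ∂(poissonMeasure r) := by
    apply norm_integral_le_of_norm_le ((integrable_const _).add (poisson_integrable_nat r))
    filter_upwards with N
    refine (lip_update hg x i j N).trans ?_
    simp only [Pi.add_apply]
    rw [abs_le]; constructor <;> linarith [Nat.cast_nonneg (α := ℝ) j, Nat.cast_nonneg (α := ℝ) N]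
  rw [integral_add (integrable_const _) (poisson_integrable_nat r), poisson_mean] at h2
  simp at h2
  have : (1:ℝ) ≤ j := by exact_mod_cast hj
  nlinarith [r.2]

theorem slice_hasSum {d : ℕ} {g : (Fin d → ℕ) → ℝ} (hg : Lip1 d g) (r : ℝ≥0) (i : Fin d)
    (x : Fin d → ℕ) :
    HasSum (fun j : ℕ => (r:ℝ) ^ j / j.factorial * slice r i g x j) 0 := by
  have hi : Integrable (slice r i g x) (poissonMeasure r) :=
    (lip_integrable_update hg r x i).sub (integrable_const _)
  have h := (hasSum_integral_poissonMeasure hi).mul_left (Real.exp r)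
  have h0 : ∫ j, slice r i g x j ∂(poissonMeasure r) = 0 := by
    unfold slice
    rw [integral_sub (lip_integrable_update hg r x i) (integrable_const _)]
    simp [avgT]
  rw [h0, mul_zero] at h
  refine h.congr_fun ?_
  intro j
  have : Real.exp r * Real.exp (-r) = 1 := by rw [← Real.exp_add]; simp
  rw [smul_eq_mul]
  linear_combination ((r:ℝ) ^ j / j.factorial * slice r i g x j) * (-this)

noncomputable def steinSol {d : ℕ} (r : ℝ≥0) (i : Fin d) (g : (Fin d → ℕ) → ℝ)
    (x : Fin d → ℕ) : ℝ := steinF r (slice r i g x) (x i)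

noncomputable def steinK (r : ℝ≥0) : ℝ := 2 * (1 + r) * Real.exp r

theorem steinSol_lip {d : ℕ} {g : (Fin d → ℕ) → ℝ} (hg : Lip1 d g) (r : ℝ≥0) (i : Fin d)
    (x y : Fin d → ℕ) (hx : 1 ≤ x i) (hy : 1 ≤ y i) :
    |steinSol r i g x - steinSol r i g y| ≤ steinK r * ∑ j, |(x j:ℝ) - y j| := by
  unfold steinSol steinK
  have hr : (0:ℝ) ≤ r := r.2
  set D := ∑ j ∈ Finset.univ.erase i, |(x j:ℝ) - y j| with hD
  have hD0 : 0 ≤ D := Finset.sum_nonneg fun _ _ => abs_nonneg _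
  rw [← Finset.add_sum_erase _ _ (Finset.mem_univ i), ← hD]
  have hB : (0:ℝ) ≤ 1 + r := by positivity
  have s1 := fun x => slice_bound hg r i x
  have h1 : |steinF r (slice r i g x) (x i) - steinF r (slice r i g y) (x i)|
      ≤ (2 * D) * Real.exp r := by
    rw [steinF_sub hr hB (s1 x) (s1 y) _ hx]
    apply steinF_bound hr (by positivity) _ _ hx
    intro j hj
    have a1 := lip_update' hg x y i j
    have a2 := avgT_sub_le hg r x y i
    have : (1:ℝ) ≤ j := by exact_mod_cast hj
    have a3 : |slice r i g x j - slice r i g y j| ≤ 2 * D := by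
      unfold slice
      rw [abs_le] at *
      constructor <;> linarith
    nlinarith
  have h2 : |steinF r (slice r i g y) (x i) - steinF r (slice r i g y) (y i)|
      ≤ 2 * (1 + r) * Real.exp r * |(x i : ℝ) - y i| := by
    by_cases h : x i = y i
    · simp [h]
    · have b1 := steinF_bound hr hB (s1 y) (x i) hx
      have b2 := steinF_bound hr hB (s1 y) (y i) hy
      have b3 : (1:ℝ) ≤ |(x i : ℝ) - y i| := by
        have : (x i : ℤ) - y i ≠ 0 := by omega
        have := Int.one_le_abs this
        exact_mod_cast this
      have b4 : |steinF r (slice r i g y) (x i) - steinF r (slice r i g y) (y i)|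
        ≤ 2 * (1 + r) * Real.exp r := by
        rw [abs_le] at *
        constructor <;> linarith
      refine b4.trans ?_
      exact le_mul_of_one_le_right (by positivity) b3
  have h3 : (2 * D) * Real.exp r ≤ 2 * (1 + r) * Real.exp r * D := by
    have : 0 ≤ r * Real.exp r * D := by positivity
    nlinarith
  have := abs_sub_le (steinF r (slice r i g x) (x i)) (steinF r (slice r i g y) (x i))
    (steinF r (slice r i g y) (y i))
  linarith

theorem slice_update {d : ℕ} (g : (Fin d → ℕ) → ℝ) (r : ℝ≥0) (i : Fin d) (x : Fin d → ℕ) (b : ℕ) :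
    slice r i g (Function.update x i b) = slice r i g x := by
  ext j
  unfold slice
  rw [avgT_update]; simp

theorem steinSol_eq {d : ℕ} {g : (Fin d → ℕ) → ℝ} (hg : Lip1 d g) (r : ℝ≥0) (i : Fin d)
    (x : Fin d → ℕ) :
    r * steinSol r i g (Function.update x i (x i + 1)) - x i * steinSol r i g x
      = g x - avgT r i g x := by
  unfold steinSol
  rw [slice_update, Function.update_self]
  have hr : (0:ℝ) ≤ r := r.2
  have := steinF_eq hr (by positivity : (0:ℝ) ≤ 1 + r) (slice_bound hg r i x)
    (slice_hasSum hg r i x) (x i)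
  rw [this]
  simp [slice]

/-- count vector -/
noncomputable def cntW {ι : Type*} {d : ℕ} (A : Fin d → Finset (Finset ι)) (ω : ι → Bool)
    (j : Fin d) : ℕ :=
  open Classical in ((A j).filter (fun S => ∀ e ∈ S, ω e = true)).card

theorem cntW_cast {ι : Type*} {d : ℕ} (A : Fin d → Finset (Finset ι)) (ω : ι → Bool)
    (j : Fin d) : (cntW A ω j : ℝ) = ∑ S ∈ A j, ind S ω := by
  classical
  unfold cntW ind
  rw [Finset.card_filter]
  push_cast
  apply Finset.sum_congr rfl
  intro S _
  congr

theorem stein_step {ι : Type*} [Fintype ι] [DecidableEq ι] {d : ℕ} {p : ℝ} (h0 : 0 ≤ p)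
    (h1 : p ≤ 1) (A : Fin d → Finset (Finset ι)) (i : Fin d) (r : ℝ≥0)
    (hr : (r:ℝ) = ∑ S ∈ A i, p ^ S.card) {g : (Fin d → ℕ) → ℝ} (hg : Lip1 d g) :
    |∫ ω, g (cntW A ω) ∂(Measure.pi fun _ : ι => bernoulliB p)
      - ∫ ω, avgT r i g (cntW A ω) ∂(Measure.pi fun _ : ι => bernoulliB p)|
    ≤ steinK r * ∑ S ∈ A i, p ^ S.card * ∫ ω, ∑ j, |(cntW A (force S ω) j : ℝ) - cntW A ω j -
        (if j = i then 1 else 0)| ∂(Measure.pi fun _ : ι => bernoulliB p) := by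
  have := bernoulliB_prob h0 h1
  set μ := (Measure.pi fun _ : ι => bernoulliB p) with hμ
  set f := steinSol r i g with hf
  rw [← integral_sub Integrable.of_finite Integrable.of_finite]
  simp_rw [← steinSol_eq hg]
  rw [integral_sub Integrable.of_finite Integrable.of_finite]
  have e1 : ∫ ω, (cntW A ω i : ℝ) * f (cntW A ω) ∂μ
      = ∑ S ∈ A i, p ^ S.card * ∫ ω, f (cntW A (force S ω)) ∂μ := by
    simp_rw [cntW_cast, Finset.sum_mul]
    rw [integral_finsetSum _ (fun _ _ => Integrable.of_finite)]
    apply Finset.sum_congr rfl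
    intro S _
    exact integral_ind_mul h0 h1 S (fun ω => f (cntW A ω))
  rw [e1, integral_const_mul, hr, Finset.sum_mul, ← Finset.sum_sub_distrib, Finset.mul_sum]
  refine (Finset.abs_sum_le_sum_abs _ _).trans ?_
  apply Finset.sum_le_sum
  intro S hS
  rw [← mul_sub, ← integral_sub Integrable.of_finite Integrable.of_finite, abs_mul,
    abs_of_nonneg (by positivity : 0 ≤ p ^ S.card)]
  rw [mul_left_comm]
  apply mul_le_mul_of_nonneg_left _ (by positivity)
  rw [← integral_const_mul, ← Real.norm_eq_abs]
  apply norm_integral_le_of_norm_le Integrable.of_finite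
  filter_upwards with ω
  have hpos : 1 ≤ cntW A (force S ω) i := by
    unfold cntW
    rw [Nat.succ_le_iff, Finset.card_pos]
    exact ⟨S, by simp [hS, force]; tauto⟩
  rw [Real.norm_eq_abs, abs_sub_comm]
  refine (steinSol_lip hg r i _ _ hpos (by simp)).trans ?_
  apply mul_le_mul_of_nonneg_left _ (by unfold steinK; positivity)
  apply Finset.sum_le_sum
  intro j _
  by_cases hj : j = i
  · subst hj; simp [sub_sub]
  · simp [hj]

theorem coupling_bound {ι : Type*} [Fintype ι] [DecidableEq ι] {d : ℕ} {p : ℝ} (h0 : 0 ≤ p)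
    (h1 : p ≤ 1) (A : Fin d → Finset (Finset ι)) (i : Fin d) (S : Finset ι) (hS : S ∈ A i)
    (hS' : ∀ j, j ≠ i → S ∉ A j) :
    ∫ ω, ∑ j, |(cntW A (force S ω) j : ℝ) - cntW A ω j -
        (if j = i then 1 else 0)| ∂(Measure.pi fun _ : ι => bernoulliB p)
    ≤ p ^ S.card + ∑ j, ∑ T ∈ (A j).filter (fun T => T ≠ S ∧ ¬ Disjoint T S), p ^ (T \ S).card := by
  have := bernoulliB_prob h0 h1
  have hpt : ∀ ω : ι → Bool, ∑ j, |(cntW A (force S ω) j : ℝ) - cntW A ω j -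
        (if j = i then 1 else 0)| ≤ ind S ω +
        ∑ j, ∑ T ∈ (A j).filter (fun T => T ≠ S ∧ ¬ Disjoint T S), ind (T \ S) ω := by
    intro ω
    have : ind S ω = ∑ j, if j = i then ind S ω else 0 := by simp
    rw [this, ← Finset.sum_add_distrib]
    apply Finset.sum_le_sum
    intro j _
    rw [cntW_cast, cntW_cast, ← Finset.sum_sub_distrib]
    simp_rw [ind_force]
    have e2 : ∑ T ∈ A j, (ind (T \ S) ω - ind T ω) - (if j = i then 1 else 0)
       = ∑ T ∈ (A j).erase S, (ind (T \ S) ω - ind T ω) - (if j = i then ind S ω else 0) := by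
      by_cases hj : j = i
      · subst hj
        rw [← Finset.add_sum_erase _ _ hS]
        have : ind (S \ S) ω = 1 := by simp [ind]
        rw [this]
        simp only [if_true]
        ring
      · rw [Finset.erase_eq_of_notMem (hS' j hj)]; simp [hj]
    rw [e2]
    have e3 : ∑ T ∈ (A j).erase S, (ind (T \ S) ω - ind T ω)
       = ∑ T ∈ (A j).filter (fun T => T ≠ S ∧ ¬ Disjoint T S), (ind (T \ S) ω - ind T ω) := by
      symm
      apply Finset.sum_subset
      · intro T; simp; tauto
      · intro T hT hT'
        simp at hT hT'
        have := hT' hT.2 hT.1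
        rw [Finset.sdiff_eq_self_of_disjoint this]; simp
    rw [e3]
    have e4 : ∀ T, 0 ≤ ind (T \ S) ω - ind T ω ∧ ind (T \ S) ω - ind T ω ≤ ind (T \ S) ω := by
      intro T
      refine ⟨?_, by linarith [ind_nonneg T ω]⟩
      unfold ind
      split_ifs with a b b
      · simp
      · simp
      · exact absurd (fun e he => b e (Finset.mem_sdiff.1 he).1) a
      · simp
    have e5 := Finset.sum_nonneg (s := (A j).filter (fun T => T ≠ S ∧ ¬ Disjoint T S))
      (fun T _ => (e4 T).1)
    have e6 := Finset.sum_le_sum (s := (A j).filter (fun T => T ≠ S ∧ ¬ Disjoint T S))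
      (fun T _ => (e4 T).2)
    have e7 : 0 ≤ (if j = i then ind S ω else 0) := by
      split_ifs
      · exact ind_nonneg S ω
      · exact le_rfl
    rw [abs_le]
    constructor <;> linarith
  refine (integral_mono Integrable.of_finite Integrable.of_finite hpt).trans ?_
  rw [integral_add Integrable.of_finite Integrable.of_finite, integral_ind h0 h1]
  rw [integral_finsetSum _ (fun _ _ => Integrable.of_finite)]
  simp_rw [integral_finsetSum _ (fun _ _ => Integrable.of_finite), integral_ind h0 h1]
  exact le_rfl

theorem lip_integrable_poissonPi {d : ℕ} {g : (Fin d → ℕ) → ℝ} (hg : Lip1 d g) (r : Fin d → ℝ≥0) :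
    Integrable g (Measure.pi fun i => poissonMeasure (r i)) := by
  refine Integrable.mono' (g := fun x => |g 0| + ∑ i, (x i : ℝ)) ?_ .of_discrete ?_
  · apply (integrable_const _).add
    apply integrable_finsetSum
    intro i _
    exact integrable_comp_eval (μ := fun i => poissonMeasure (r i)) (f := fun n : ℕ => (n:ℝ))
      (poisson_integrable_nat (r i))
  · filter_upwards with x
    have h := hg x 0
    have h2 := abs_sub_abs_le_abs_sub (g x) (g 0)
    simp at h ⊢
    linarith

theorem const_of_update {d : ℕ} {g : (Fin d → ℕ) → ℝ}
    (h : ∀ i x b, g (Function.update x i b) = g x) (x y : Fin d → ℕ) : g x = g y := by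
  have : ∀ s : Finset (Fin d), g (s.piecewise x y) = g y := by
    intro s
    induction s using Finset.induction_on with
    | empty => simp
    | insert j s hj ih => rw [Finset.piecewise_insert, h, ih]
  simpa using this Finset.univ

theorem telescope {Ω : Type*} [MeasurableSpace Ω] (μ : Measure Ω) [IsProbabilityMeasure μ]
    {d : ℕ} (W : Ω → Fin d → ℕ) (r : Fin d → ℝ≥0) (ε : Fin d → ℝ)
    (hstep : ∀ i g, Lip1 d g → |∫ ω, g (W ω) ∂μ - ∫ ω, avgT (r i) i g (W ω) ∂μ| ≤ ε i)
    (s : Finset (Fin d)) : ∀ g : (Fin d → ℕ) → ℝ, Lip1 d g →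
      (∀ i, i ∉ s → ∀ x b, g (Function.update x i b) = g x) →
      |∫ ω, g (W ω) ∂μ - ∫ x, g x ∂(Measure.pi fun i => poissonMeasure (r i))| ≤ ∑ i ∈ s, ε i := by
  induction s using Finset.induction_on with
  | empty =>
    intro g hg hi
    have hc : g = fun _ => g 0 := by
      ext x
      exact const_of_update (fun i x b => hi i (by simp) x b) x 0
    rw [hc]
    simp
  | insert i s his ih =>
    intro g hg hi
    rw [Finset.sum_insert his]
    have a1 := hstep i g hg
    have a2 := ih (avgT (r i) i g) (avgT_lip hg _ _) (by
      intro j hj x b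
      by_cases hji : j = i
      · subst hji; exact avgT_update _ _ _ _ _
      · unfold avgT
        congr 1
        ext N
        rw [Function.update_comm hji]
        exact hi j (by simp [hji, hj]) _ _)
    have a3 : ∫ x, g x ∂(Measure.pi fun i => poissonMeasure (r i))
        = ∫ x, avgT (r i) i g x ∂(Measure.pi fun i => poissonMeasure (r i)) :=
      integral_resample _ i g (lip_integrable_poissonPi hg r)
    rw [a3]
    have := abs_sub_le (∫ ω, g (W ω) ∂μ) (∫ ω, avgT (r i) i g (W ω) ∂μ)
      (∫ x, avgT (r i) i g x ∂(Measure.pi fun i => poissonMeasure (r i)))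
    linarith

/-- Abstract bound. -/
theorem abstract_bound {ι : Type*} [Fintype ι] [DecidableEq ι] {d : ℕ} {p : ℝ} (h0 : 0 ≤ p)
    (h1 : p ≤ 1) (A : Fin d → Finset (Finset ι))
    (hA : ∀ i j S, j ≠ i → S ∈ A i → S ∉ A j) (lam : Fin d → ℝ)
    (hlam : ∀ i, lam i = ∑ S ∈ A i, p ^ S.card) (δ : Fin d → ℝ)
    (hδ : ∀ i, ∀ S ∈ A i, p ^ S.card + ∑ j, ∑ T ∈ (A j).filter (fun T => T ≠ S ∧ ¬ Disjoint T S),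
      p ^ (T \ S).card ≤ δ i) :
    distW (Measure.map (fun ω => cntW A ω) (Measure.pi fun _ : ι => bernoulliB p)) (poissonPi lam)
      ≤ ENNReal.ofReal (∑ i, 2 * (1 + lam i) * Real.exp (lam i) * (lam i * δ i)) := by
  have := bernoulliB_prob h0 h1
  unfold distW
  apply iSup₂_le
  intro g hg
  apply ENNReal.ofReal_le_ofReal
  rw [integral_map (Measurable.of_discrete).aemeasurable .of_discrete]
  have hl0 : ∀ i, 0 ≤ lam i := fun i => by
    rw [hlam]; exact Finset.sum_nonneg fun _ _ => by positivity
  unfold poissonPi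
  apply telescope (Measure.pi fun _ : ι => bernoulliB p) (cntW A) (fun i => (lam i).toNNReal) _ _
    Finset.univ g hg (by simp)
  intro i g hg
  have hc : (((lam i).toNNReal : ℝ≥0) : ℝ) = lam i := Real.coe_toNNReal _ (hl0 i)
  refine (stein_step h0 h1 A i _ (by rw [hc, hlam]) hg).trans ?_
  unfold steinK
  rw [hc]
  have := hl0 i
  apply mul_le_mul_of_nonneg_left _ (by positivity)
  conv_rhs => rw [hlam i, Finset.sum_mul]
  apply Finset.sum_le_sum
  intro S hS
  apply mul_le_mul_of_nonneg_left _ (by positivity)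
  exact (coupling_bound h0 h1 A i S hS (fun j hj => hA i j S hj hS)).trans (hδ i S hS)

open MeasureTheory ProbabilityTheory Filter
open scoped ENNReal NNReal

abbrev EdgeT (n : ℕ) := {e : Sym2 (Fin n) // ¬ e.IsDiag}

theorem fin_one_ne {m : ℕ} : (1 : Fin (m+3)) ≠ 0 := by
  intro h
  have := congrArg Fin.val h
  simp at this

theorem fin_two_ne {m : ℕ} : (1 + 1 : Fin (m+3)) ≠ 0 := by
  intro h
  have := congrArg Fin.val h
  simp [Fin.val_add] at this
  rw [Nat.mod_eq_of_lt (by omega)] at this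
  omega

theorem fin_cyc {m : ℕ} (P : Fin (m+3) → Prop) (h : ∀ t, P t → P (t+1)) {t0} (h0 : P t0) :
    ∀ t, P t := by
  have h1 : ∀ j : ℕ, P (t0 + (Fin.ofNat (m+3) j)) := by
    intro j
    induction j with
    | zero => simpa [Fin.ofNat] using h0
    | succ j ih =>
      have := h _ ih
      have e : t0 + Fin.ofNat (m+3) j + 1 = t0 + Fin.ofNat (m+3) (j+1) := by
        rw [add_assoc]
        congr 1
        ext
        simp [Fin.val_add, Fin.ofNat]
      rwa [e] at this
  intro t
  have := h1 (t - t0).val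
  have e : t0 + Fin.ofNat (m+3) (t - t0).val = t := by
    simp
  rwa [e] at this

theorem fin_cyc' {m : ℕ} (P : Fin (m+3) → Prop) (h : ∀ t, P (t+1) → P t) {t0} (h0 : P t0) :
    ∀ t, P t := by
  by_contra! hc
  obtain ⟨t1, h1⟩ := hc
  exact fin_cyc (fun t => ¬ P t) (fun t ht ht' => ht (h t ht')) h1 t0 h0

def edg {m n : ℕ} (b : Fin (m+3) ↪ Fin n) (t : Fin (m+3)) : EdgeT n :=
  ⟨s(b t, b (t+1)), by
    simp only [Sym2.mk_isDiag_iff]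
    intro h
    have := b.injective h
    simp at this⟩

def cyc {m n : ℕ} (b : Fin (m+3) ↪ Fin n) : Finset (EdgeT n) := Finset.univ.image (edg b)

theorem add_one_add_one_ne {m : ℕ} (u : Fin (m+3)) : u + 1 + 1 ≠ u := by
  intro h
  apply fin_two_ne (m := m)
  rw [add_assoc] at h
  simpa using h

theorem edg_injective {m n : ℕ} (b : Fin (m+3) ↪ Fin n) : Function.Injective (edg b) := by
  intro t u h
  have h := congrArg Subtype.val h
  simp only [edg, Sym2.eq_iff, EmbeddingLike.apply_eq_iff_eq] at h
  rcases h with h | ⟨h1, h2⟩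
  · exact h.1
  · subst h1
    exact absurd h2 (add_one_add_one_ne u)

theorem card_cyc {m n : ℕ} (b : Fin (m+3) ↪ Fin n) : (cyc b).card = m + 3 := by
  rw [cyc, Finset.card_image_of_injective _ (edg_injective b)]
  simp

theorem mem_cyc {m n : ℕ} (b : Fin (m+3) ↪ Fin n) (e : EdgeT n) :
    e ∈ cyc b ↔ ∃ t, s(b t, b (t+1)) = e.1 := by
  simp [cyc, edg, Subtype.ext_iff]

theorem nbr {m n : ℕ} (a : Fin (m+3) ↪ Fin n) (e : EdgeT n) (he : e ∈ cyc a) (s : Fin (m+3))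
    (y : Fin n) (hy : e.1 = s(a s, y)) : y = a (s+1) ∨ y = a (s-1) := by
  obtain ⟨t, ht⟩ := (mem_cyc a e).1 he
  rw [hy, Sym2.eq_iff] at ht
  rcases ht with ⟨h1, h2⟩ | ⟨h1, h2⟩
  · left; rw [← h2, a.injective h1]
  · right; rw [← h1, ← a.injective h2]; simp

theorem mem_range_of_mem {m n : ℕ} (a : Fin (m+3) ↪ Fin n) (e : EdgeT n) (he : e ∈ cyc a)
    (x : Fin n) (hx : x ∈ e.1) : ∃ s, a s = x := by
  obtain ⟨t, ht⟩ := (mem_cyc a e).1 he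
  rw [← ht, Sym2.mem_iff] at hx
  rcases hx with h | h
  · exact ⟨_, h.symm⟩
  · exact ⟨_, h.symm⟩

theorem edg_mem {m n : ℕ} (b : Fin (m+3) ↪ Fin n) (t) : edg b t ∈ cyc b := by
  simp [cyc]

theorem cyc_nbrs {m m' n : ℕ} (a : Fin (m+3) ↪ Fin n) (b : Fin (m'+3) ↪ Fin n)
    (h : cyc b ⊆ cyc a) (t s) (hts : b t = a s) :
    (b (t+1) = a (s+1) ∧ b (t-1) = a (s-1)) ∨ (b (t+1) = a (s-1) ∧ b (t-1) = a (s+1)) := by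
  have h1 := nbr a (edg b t) (h (edg_mem b t)) s (b (t+1)) (by simp [edg, hts])
  have h2 := nbr a (edg b (t-1)) (h (edg_mem b (t-1))) s (b (t-1)) (by simp [edg, hts, Sym2.eq_swap])
  have h3 : b (t+1) ≠ b (t-1) := by
    intro h
    have h := b.injective h
    have := add_one_add_one_ne (t-1)
    simp [h] at this
  rcases h1 with h1 | h1 <;> rcases h2 with h2 | h2
  · exact absurd (h1.trans h2.symm) h3
  · exact Or.inl ⟨h1, h2⟩
  · exact Or.inr ⟨h1, h2⟩
  · exact absurd (h1.trans h2.symm) h3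

theorem cyc_eq_of_subset {m m' n : ℕ} (a : Fin (m+3) ↪ Fin n) (b : Fin (m'+3) ↪ Fin n)
    (h : cyc b ⊆ cyc a) : cyc b = cyc a := by
  apply Finset.Subset.antisymm h
  have key : ∀ s, (∃ t, b t = a s) → edg a s ∈ cyc b ∧ ∃ t, b t = a (s+1) := by
    rintro s ⟨t, ht⟩
    rcases cyc_nbrs a b h t s ht with ⟨h1, h2⟩ | ⟨h1, h2⟩
    · refine ⟨?_, _, h1⟩
      rw [mem_cyc]
      exact ⟨t, by simp [edg, ht, h1]⟩
    · refine ⟨?_, _, h2⟩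
      rw [mem_cyc]
      exact ⟨t-1, by simp [edg, ht, h2, Sym2.eq_swap]⟩
  obtain ⟨s0, hs0⟩ := mem_range_of_mem a (edg b 0) (h (edg_mem b 0)) (b 0) (by simp [edg])
  have all := fin_cyc (fun s => ∃ t, b t = a s) (fun s hs => (key s hs).2) ⟨0, hs0.symm⟩
  intro e he
  simp only [cyc, Finset.mem_image, Finset.mem_univ, true_and] at he
  obtain ⟨s, rfl⟩ := he
  exact (key s (all s)).1

theorem cyc_eq_cases {m n : ℕ} (a b : Fin (m+3) ↪ Fin n)
    (h : cyc b = cyc a) : ∃ s, (∀ t, b t = a (s + t)) ∨ (∀ t, b t = a (s - t)) := by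
  obtain ⟨s0, hs0⟩ := mem_range_of_mem a (edg b 0) (h ▸ (edg_mem b 0)) (b 0) (by simp [edg])
  refine ⟨s0, ?_⟩
  have hsub : cyc b ⊆ cyc a := h ▸ Finset.Subset.refl _
  have hne : ∀ s, a (s+1) ≠ a (s-1) := by
    intro s h
    have h := a.injective h
    have := add_one_add_one_ne (s-1)
    simp [h] at this
  rcases cyc_nbrs a b hsub 0 s0 hs0.symm with ⟨h1, h2⟩ | ⟨h1, h2⟩
  · left
    have := fin_cyc (fun t => b t = a (s0 + t) ∧ b (t+1) = a (s0 + t + 1)) (t0 := 0) (by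
      rintro t ⟨ht, ht1⟩
      refine ⟨by rw [ht1, add_assoc], ?_⟩
      rcases cyc_nbrs a b hsub (t+1) (s0 + t + 1) ht1 with ⟨q1, q2⟩ | ⟨q1, q2⟩
      · rw [q1]; congr 1; abel
      · exfalso
        simp only [add_sub_cancel_right] at q2
        rw [ht] at q2
        have := a.injective q2
        exact add_one_add_one_ne _ this.symm) ⟨by simp [hs0], by simpa using h1⟩
    exact fun t => (this t).1
  · right
    have := fin_cyc (fun t => b t = a (s0 - t) ∧ b (t+1) = a (s0 - t - 1)) (t0 := 0) (by
      rintro t ⟨ht, ht1⟩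
      refine ⟨by rw [ht1, sub_sub], ?_⟩
      rcases cyc_nbrs a b hsub (t+1) (s0 - t - 1) ht1 with ⟨q1, q2⟩ | ⟨q1, q2⟩
      · exfalso
        simp only [add_sub_cancel_right] at q2
        rw [ht] at q2
        have := a.injective q2
        have := add_one_add_one_ne (s0 - t - 1 - 1)
        simp at this
        tauto
      · rw [q1]; congr 1; abel) ⟨by simp [hs0], by simpa using h1⟩
    exact fun t => (this t).1

def dih {m n : ℕ} (a : Fin (m+3) ↪ Fin n) (q : Fin (m+3) × Bool) : Fin (m+3) ↪ Fin n :=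
  ⟨fun t => if q.2 then a (q.1 + t) else a (q.1 - t), by
    intro t u h
    rcases q with ⟨s, _ | _⟩ <;> simpa using h⟩

theorem dih_injective {m n : ℕ} (a : Fin (m+3) ↪ Fin n) : Function.Injective (dih a) := by
  rintro ⟨s, e⟩ ⟨s', e'⟩ h
  have hs : ∀ t, dih a (s, e) t = dih a (s', e') t := fun t => by rw [h]
  have h0 : s = s' := by
    have := hs 0
    rcases e with _ | _ <;> rcases e' with _ | _ <;> simpa [dih] using this
  subst h0
  have h1 := hs 1
  have hne : s + 1 ≠ s - 1 := by
    intro h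
    have := add_one_add_one_ne (s-1)
    simp [h] at this
  rcases e with _ | _ <;> rcases e' with _ | _ <;> simp [dih] at h1 ⊢
  · exact hne h1.symm
  · exact hne h1

theorem cyc_dih {m n : ℕ} (a : Fin (m+3) ↪ Fin n) (q) : cyc (dih a q) = cyc a := by
  apply cyc_eq_of_subset
  intro e he
  simp only [cyc, Finset.mem_image, Finset.mem_univ, true_and] at he
  obtain ⟨t, rfl⟩ := he
  rw [mem_cyc]
  rcases q with ⟨s, _ | _⟩
  · refine ⟨s - t - 1, ?_⟩
    have : s - (t + 1) + 1 = s - t := by abel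
    simp [edg, dih, sub_sub, this]
  · refine ⟨s + t, ?_⟩
    simp [edg, dih, add_assoc]

theorem card_fiber {m n : ℕ} (a : Fin (m+3) ↪ Fin n) :
    (Finset.univ.filter (fun b : Fin (m+3) ↪ Fin n => cyc b = cyc a)).card = 2 * (m+3) := by
  have : Finset.univ.filter (fun b : Fin (m+3) ↪ Fin n => cyc b = cyc a)
     = Finset.univ.image (dih a) := by
    ext b
    simp only [Finset.mem_filter, Finset.mem_univ, true_and, Finset.mem_image]
    constructor
    · intro h
      obtain ⟨s, h | h⟩ := cyc_eq_cases a b h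
      · exact ⟨(s, true), by ext t; simp [dih, h]⟩
      · exact ⟨(s, false), by ext t; simp [dih, h]⟩
    · rintro ⟨q, rfl⟩
      exact cyc_dih a q
  rw [this, Finset.card_image_of_injective _ (dih_injective a)]
  simp [mul_comm]

/-- All `m+3`-cycles as edge sets. -/
noncomputable def cycSet (n m : ℕ) : Finset (Finset (EdgeT n)) :=
  Finset.univ.image (fun b : Fin (m+3) ↪ Fin n => cyc b)

theorem card_cycSet (n m : ℕ) : (cycSet n m).card * (2 * (m+3)) = n.descFactorial (m+3) := by
  have h := Finset.card_eq_sum_card_image (fun b : Fin (m+3) ↪ Fin n => cyc b) Finset.univ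
  rw [Finset.card_univ, Fintype.card_embedding_eq, Fintype.card_fin, Fintype.card_fin] at h
  rw [h, ← smul_eq_mul, ← Finset.sum_const]
  apply Finset.sum_congr rfl
  intro S hS
  simp only [cycSet, Finset.mem_image, Finset.mem_univ, true_and] at hS
  obtain ⟨a, rfl⟩ := hS
  rw [card_fiber]

theorem key_count {m m' n : ℕ} (a : Fin (m+3) ↪ Fin n) (b : Fin (m'+3) ↪ Fin n)
    (hne : cyc b ≠ cyc a) (hd : ¬ Disjoint (cyc b) (cyc a)) :
    (Finset.univ.filter (fun t => b t ∉ Set.range a)).card + 1 ≤ (cyc b \ cyc a).card := by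
  classical
  set R := Finset.univ.filter (fun t => b t ∉ Set.range a) with hR
  set S := Finset.univ.filter (fun t => edg b t ∉ cyc a) with hS
  have e1 : (cyc b \ cyc a) = S.image (edg b) := by
    ext e
    simp only [cyc, hS, Finset.mem_sdiff, Finset.mem_image, Finset.mem_filter, Finset.mem_univ, true_and]
    constructor
    · rintro ⟨⟨t, rfl⟩, h⟩
      exact ⟨t, h, rfl⟩
    · rintro ⟨t, h, rfl⟩
      exact ⟨⟨t, rfl⟩, h⟩
  rw [e1, Finset.card_image_of_injective _ (edg_injective b), Nat.succ_le_iff]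
  apply Finset.card_lt_card
  have hsub : R ⊆ S := by
    intro t ht
    simp only [hR, hS, Finset.mem_filter, Finset.mem_univ, true_and, Set.mem_range] at ht ⊢
    intro h
    exact ht (mem_range_of_mem a _ h _ (by simp [edg]))
  refine Finset.ssubset_iff_subset_ne.2 ⟨hsub, fun heq => ?_⟩
  have hcl : ∀ t, (t + 1) ∈ R → t ∈ R := by
    intro t ht
    rw [heq]
    simp only [hR, hS, Finset.mem_filter, Finset.mem_univ, true_and, Set.mem_range] at ht ⊢
    intro h
    exact ht (mem_range_of_mem a _ h _ (by simp [edg]))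
  by_cases hemp : ∃ t, t ∈ R
  · obtain ⟨t0, h0⟩ := hemp
    have all := fin_cyc' (fun t => t ∈ R) hcl h0
    apply hd
    rw [Finset.disjoint_left]
    intro e he
    simp only [cyc, Finset.mem_image, Finset.mem_univ, true_and] at he
    obtain ⟨t, rfl⟩ := he
    have := all t
    rw [heq] at this
    simpa [hS] using this
  · push Not at hemp
    apply hne
    apply cyc_eq_of_subset
    intro e he
    simp only [cyc, Finset.mem_image, Finset.mem_univ, true_and] at he
    obtain ⟨t, rfl⟩ := he
    have := hemp t
    rw [heq] at this
    simpa [hS] using this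

theorem overlap_sum {m m' n : ℕ} {p : ℝ} (h0 : 0 ≤ p) (h1 : p ≤ 1) (a : Fin (m+3) ↪ Fin n) :
    ∑ T ∈ (cycSet n m').filter (fun T => T ≠ cyc a ∧ ¬ Disjoint T (cyc a)), p ^ (T \ cyc a).card
      ≤ p * ((m + 3 : ℕ) + n * p) ^ (m' + 3) := by
  classical
  set w : Fin n → ℝ := fun v => if v ∈ Set.range a then 1 else p with hw
  have hw0 : ∀ v, 0 ≤ w v := by intro v; simp only [hw]; split_ifs <;> linarith
  have hsum : ∑ v, w v ≤ (m + 3 : ℕ) + n * p := by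
    have : ∀ v, w v ≤ (if v ∈ Finset.univ.image a then 1 else 0) + p := by
      intro v
      simp only [hw]
      by_cases hv : v ∈ Set.range a
      · have : v ∈ Finset.univ.image a := by simpa using hv
        rw [if_pos hv, if_pos this]; linarith
      · rw [if_neg hv]
        have : (0:ℝ) ≤ (if v ∈ Finset.univ.image a then 1 else 0) := by split_ifs <;> norm_num
        linarith
    refine (Finset.sum_le_sum fun v _ => this v).trans ?_
    rw [Finset.sum_add_distrib]
    simp [-Finset.mem_image, Finset.card_image_of_injective _ a.injective]
  set B := Finset.univ.filter (fun b : Fin (m'+3) ↪ Fin n => cyc b ≠ cyc a ∧ ¬ Disjoint (cyc b) (cyc a)) with hB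
  have himg : (cycSet n m').filter (fun T => T ≠ cyc a ∧ ¬ Disjoint T (cyc a)) = B.image (fun b => cyc b) := by
    rw [cycSet, Finset.filter_image]
  calc _ = ∑ T ∈ B.image (fun b => cyc b), p ^ (T \ cyc a).card := by rw [himg]
    _ ≤ ∑ b ∈ B, p ^ (cyc b \ cyc a).card := by
      rw [Finset.sum_comp (fun T : Finset (EdgeT n) => p ^ (T \ cyc a).card) (fun b => cyc b)]
      apply Finset.sum_le_sum
      intro T hT
      simp only [Finset.mem_image] at hT
      obtain ⟨b, hb, hbT⟩ := hT
      rw [nsmul_eq_mul]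
      apply le_mul_of_one_le_left (by positivity)
      norm_cast
      rw [Nat.succ_le_iff, Finset.card_pos]
      exact ⟨b, by simp [hb, hbT]⟩
    _ ≤ ∑ b ∈ B, p * ∏ t, w (b t) := by
      apply Finset.sum_le_sum
      intro b hb
      simp only [hB, Finset.mem_filter, Finset.mem_univ, true_and] at hb
      have hk := key_count a b hb.1 hb.2
      refine (pow_le_pow_of_le_one h0 h1 hk).trans ?_
      rw [pow_succ, mul_comm]
      apply le_of_eq
      congr 1
      simp only [hw]
      rw [Finset.prod_ite]
      simp
    _ ≤ ∑ b : Fin (m'+3) ↪ Fin n, p * ∏ t, w (b t) :=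
      Finset.sum_le_sum_of_subset_of_nonneg (Finset.subset_univ _)
        (fun b _ _ => mul_nonneg h0 (Finset.prod_nonneg fun t _ => hw0 _))
    _ ≤ ∑ b : Fin (m'+3) → Fin n, p * ∏ t, w (b t) := by
      rw [← Finset.sum_image (s := Finset.univ) (g := fun b : Fin (m'+3) ↪ Fin n => (b : Fin (m'+3) → Fin n))
        (f := fun b => p * ∏ t, w (b t)) (by intro x _ y _ h; exact DFunLike.coe_injective h)]
      exact Finset.sum_le_sum_of_subset_of_nonneg (Finset.subset_univ _)
        (fun b _ _ => mul_nonneg h0 (Finset.prod_nonneg fun t _ => hw0 _))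
    _ = p * (∑ v, w v) ^ (m'+3) := by
      rw [← Finset.mul_sum, Fintype.sum_pow]
    _ ≤ _ := by
      apply mul_le_mul_of_nonneg_left _ h0
      exact pow_le_pow_left₀ (Finset.sum_nonneg fun v _ => hw0 v) hsum _

open MeasureTheory ProbabilityTheory Filter
open scoped ENNReal NNReal

noncomputable def edgesOf {n : ℕ} (B : (⊤ : SimpleGraph (Fin n)).Subgraph) : Finset (EdgeT n) :=
  open Classical in Finset.univ.filter (fun e => e.1 ∈ B.edgeSet)

theorem mem_edgesOf {n : ℕ} (B : (⊤ : SimpleGraph (Fin n)).Subgraph) (e : EdgeT n) :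
    e ∈ edgesOf B ↔ e.1 ∈ B.edgeSet := by simp [edgesOf]

theorem cycle_adj_iff {m : ℕ} (t u : Fin (m+3)) :
    (SimpleGraph.cycleGraph (m+3)).Adj t u ↔ t = u + 1 ∨ u = t + 1 := by
  rw [SimpleGraph.cycleGraph_adj (n := m+1), sub_eq_iff_eq_add', sub_eq_iff_eq_add']

theorem copy_cyc {n m : ℕ} (B : (⊤ : SimpleGraph (Fin n)).Subgraph)
    (h : IsCopy (SimpleGraph.cycleGraph (m+3)) B) :
    ∃ b : Fin (m+3) ↪ Fin n, edgesOf B = cyc b ∧ B.verts = Set.range b := by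
  obtain ⟨φ⟩ := h
  obtain ⟨b, hb⟩ : ∃ b : Fin (m+3) ↪ Fin n, ∀ t, b t = (φ.symm t).1 :=
    ⟨⟨fun t => (φ.symm t).1, fun t u h => φ.symm.injective (Subtype.ext h)⟩, fun _ => rfl⟩
  refine ⟨b, ?_, ?_⟩
  · ext ⟨e, he⟩
    rw [mem_edgesOf, mem_cyc]
    constructor
    · induction e using Sym2.ind with
      | _ x y =>
        intro h
        rw [SimpleGraph.Subgraph.mem_edgeSet] at h
        have hx := B.edge_vert h
        have hy := B.edge_vert h.symm
        have h2 : B.coe.Adj ⟨x, hx⟩ ⟨y, hy⟩ := h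
        rw [← φ.map_adj_iff, cycle_adj_iff] at h2
        rcases h2 with h2 | h2
        · refine ⟨φ ⟨y, hy⟩, ?_⟩
          rw [← h2, hb, hb]; simp [Sym2.eq_swap]
        · refine ⟨φ ⟨x, hx⟩, ?_⟩
          rw [← h2, hb, hb]; simp
    · rintro ⟨t, ht⟩
      have : B.coe.Adj (φ.symm t) (φ.symm (t+1)) := by
        rw [φ.symm.map_adj_iff, cycle_adj_iff]; right; rfl
      rw [hb, hb] at ht
      have h3 : s((φ.symm t).1, (φ.symm (t+1)).1) ∈ B.edgeSet := this
      first | exact ht ▸ h3 | exact ht.symm ▸ h3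
  · ext x
    rw [Set.mem_range]
    constructor
    · intro h
      exact ⟨φ ⟨x, h⟩, by rw [hb]; simp⟩
    · rintro ⟨t, rfl⟩
      rw [hb]
      exact (φ.symm t).2

theorem cyc_copy {n m : ℕ} (b : Fin (m+3) ↪ Fin n) :
    ∃ B : (⊤ : SimpleGraph (Fin n)).Subgraph, IsCopy (SimpleGraph.cycleGraph (m+3)) B ∧
      edgesOf B = cyc b := by
  let B : (⊤ : SimpleGraph (Fin n)).Subgraph :=
    { verts := Set.range b
      Adj := fun x y => ∃ t, s(b t, b (t+1)) = s(x, y)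
      adj_sub := by
        rintro x y ⟨t, ht⟩
        rw [SimpleGraph.top_adj]
        rintro rfl
        have := (edg b t).2
        simp only [edg] at this
        rw [ht] at this
        simp at this
      edge_vert := by
        rintro x y ⟨t, ht⟩
        rw [Sym2.eq_iff] at ht
        rcases ht with ht | ht
        · exact ⟨_, ht.1⟩
        · exact ⟨_, ht.2⟩
      symm := ⟨by
        rintro x y ⟨t, ht⟩
        exact ⟨t, by rw [ht, Sym2.eq_swap]⟩⟩ }
  refine ⟨B, ⟨?_⟩, ?_⟩
  · refine SimpleGraph.Iso.symm ⟨Equiv.ofInjective b b.injective, ?_⟩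
    intro t u
    rw [cycle_adj_iff]
    change (∃ v, s(b v, b (v+1)) = s(b t, b u)) ↔ _
    simp only [Sym2.eq_iff, EmbeddingLike.apply_eq_iff_eq]
    constructor
    · rintro ⟨v, ⟨rfl, rfl⟩ | ⟨rfl, rfl⟩⟩ <;> simp
    · rintro (rfl | rfl)
      · exact ⟨u, by simp⟩
      · exact ⟨t, by simp⟩
  · ext ⟨e, he⟩
    rw [mem_edgesOf, mem_cyc]
    induction e using Sym2.ind with
    | _ x y => exact Iff.rfl

theorem erGraph_edge {n : ℕ} (ω : EdgeSpace n) (e : EdgeT n) :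
    e.1 ∈ (erGraph ω).edgeSet ↔ ω e = true := by
  obtain ⟨e, he⟩ := e
  simp [erGraph, he]

theorem edges_subset_iff {n : ℕ} (ω : EdgeSpace n) (B : (⊤ : SimpleGraph (Fin n)).Subgraph) :
    B.edgeSet ⊆ (erGraph ω).edgeSet ↔ ∀ e ∈ edgesOf B, ω e = true := by
  constructor
  · intro h e he
    rw [← erGraph_edge]
    exact h ((mem_edgesOf B e).1 he)
  · intro h e he
    have hd : ¬ e.IsDiag := (⊤ : SimpleGraph (Fin n)).not_isDiag_of_mem_edgeSet (B.edgeSet_subset he)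
    have := h ⟨e, hd⟩ ((mem_edgesOf B _).2 he)
    rwa [← erGraph_edge] at this

theorem edgesOf_injOn {n m : ℕ} (B B' : (⊤ : SimpleGraph (Fin n)).Subgraph)
    (h : IsCopy (SimpleGraph.cycleGraph (m+3)) B) (h' : IsCopy (SimpleGraph.cycleGraph (m+3)) B')
    (he : edgesOf B = edgesOf B') : B = B' := by
  have hadj : ∀ x y, B.Adj x y ↔ B'.Adj x y := by
    intro x y
    by_cases hxy : x = y
    · subst hxy
      exact ⟨fun h => absurd rfl h.ne, fun h => absurd rfl h.ne⟩
    · have h1 := mem_edgesOf B ⟨s(x,y), by simpa using hxy⟩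
      have h2 := mem_edgesOf B' ⟨s(x,y), by simpa using hxy⟩
      rw [he, h2] at h1
      simpa using h1.symm
  have hv : ∀ (B : (⊤ : SimpleGraph (Fin n)).Subgraph),
      IsCopy (SimpleGraph.cycleGraph (m+3)) B → ∀ x, x ∈ B.verts ↔ ∃ y, B.Adj x y := by
    rintro B h x
    constructor
    · intro hx
      obtain ⟨φ⟩ := h
      refine ⟨(φ.symm (φ ⟨x, hx⟩ + 1)).1, ?_⟩
      have : B.coe.Adj (φ.symm (φ ⟨x, hx⟩)) (φ.symm (φ ⟨x, hx⟩ + 1)) := by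
        rw [φ.symm.map_adj_iff, cycle_adj_iff]; right; rfl
      simpa using this
    · rintro ⟨y, hy⟩
      exact B.edge_vert hy
  ext x y
  · rw [hv B h, hv B' h']; simp [hadj]
  · exact hadj x y

theorem numCopies_eq {n m : ℕ} (ω : EdgeSpace n) :
    numCopies (SimpleGraph.cycleGraph (m+3)) (erGraph ω)
      = open Classical in ((cycSet n m).filter (fun S => ∀ e ∈ S, ω e = true)).card := by
  classical
  unfold numCopies
  rw [← Set.ncard_image_of_injOn (f := edgesOf)
    (fun B hB B' hB' he => edgesOf_injOn B B' hB.1 hB'.1 he), ← Set.ncard_coe_finset]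
  congr 1
  ext S
  simp only [Set.mem_image, Set.mem_setOf_eq, Finset.coe_filter, cycSet, Finset.mem_image,
    Finset.mem_univ, true_and, edges_subset_iff]
  constructor
  · rintro ⟨B, ⟨h1, h2⟩, rfl⟩
    obtain ⟨b, hb, _⟩ := copy_cyc B h1
    exact ⟨⟨b, hb.symm⟩, h2⟩
  · rintro ⟨⟨b, rfl⟩, h2⟩
    obtain ⟨B, h1, hB⟩ := cyc_copy b
    exact ⟨B, ⟨h1, by rwa [hB]⟩, hB⟩

theorem lam_formula {d : ℕ} (n : ℕ) (m : Fin d → ℕ) (p : ℝ) (i : Fin d) :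
    ∑ S ∈ cycSet n (m i), p ^ S.card
      = (n.descFactorial (m i + 3) : ℝ) / (2 * ((m i + 3 : ℕ) : ℝ)) * p ^ (m i + 3) := by
  have h1 : ∀ S ∈ cycSet n (m i), p ^ S.card = p ^ (m i + 3) := by
    intro S hS
    simp only [cycSet, Finset.mem_image, Finset.mem_univ, true_and] at hS
    obtain ⟨b, rfl⟩ := hS
    rw [card_cyc]
  rw [Finset.sum_congr rfl h1, Finset.sum_const, nsmul_eq_mul, ← card_cycSet]
  push_cast
  field_simp

theorem lam_tendsto (c : ℝ) (hc : 0 < c) (p : ℕ → ℝ)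
    (hnp : Tendsto (fun n : ℕ => n * p n) atTop (nhds c)) (k : ℕ) :
    Tendsto (fun n : ℕ => (n.descFactorial k : ℝ) / (2 * (k : ℝ)) * (p n) ^ k) atTop
      (nhds (c ^ k / (2 * (k:ℝ)))) := by
  have hdf : ∀ k, Tendsto (fun n : ℕ => (n.descFactorial k : ℝ) * (p n) ^ k) atTop (nhds (c ^ k)) := by
    intro k
    induction k with
    | zero => simp
    | succ k ih =>
      have hp0 : Tendsto p atTop (nhds 0) := by
        have := hnp.mul (tendsto_inv_atTop_nhds_zero_nat (𝕜 := ℝ))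
        rw [mul_zero] at this
        refine this.congr' ?_
        filter_upwards [eventually_gt_atTop 0] with n hn
        field_simp
      have h1 : Tendsto (fun n : ℕ => n * p n - k * p n) atTop (nhds c) := by
        have := hnp.sub (hp0.const_mul (k:ℝ))
        simpa using this
      have h2 := h1.mul ih
      rw [pow_succ']
      refine h2.congr' ?_
      filter_upwards [eventually_ge_atTop k] with n hn
      rw [Nat.descFactorial_succ, pow_succ]
      push_cast [hn]
      ring
  have := (hdf k).div_const (2 * (k:ℝ))
  refine this.congr fun n => ?_
  ring

theorem np_tendsto (c : ℝ) (hc : 0 < c) (p : ℕ → ℝ)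
    (hpc : Tendsto (fun n : ℕ => p n / (c / (n : ℝ))) atTop (nhds 1)) :
    Tendsto (fun n : ℕ => n * p n) atTop (nhds c) := by
  have := hpc.const_mul c
  rw [mul_one] at this
  refine this.congr fun n => ?_
  by_cases hn : (n:ℝ) = 0
  · simp [hn]
  · field_simp

/-- For distinct cycles `H_1, …, H_d` of lengths `3 ≤ k_1 < ⋯ < k_d` and
`p = c n^{-1} (1 + o(1))`, the joint cycle counts satisfy
`E(W_i) = n(n−1)⋯(n−k_i+1)/(2k_i) ⋅ p^{k_i} → c^{k_i}/(2 k_i)` and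
`d_W((W_1, …, W_d), P_λ) ≤ C n^{-1}` for large `n`. -/
theorem distW_cycle_counts
    {d : ℕ} (hd : 2 ≤ d) (k : Fin d → ℕ)
    (hk3 : ∀ i, 3 ≤ k i) (hkmono : StrictMono k)
    (c : ℝ) (hc : 0 < c)
    (p : ℕ → ℝ) (hp : ∀ n, 0 < p n ∧ p n < 1)
    -- `p = c n^{-1} (1 + o(1))`
    (hpc : Tendsto (fun n : ℕ => p n / (c / (n : ℝ))) atTop (nhds 1))
    (W : (n : ℕ) → Fin d → EdgeSpace n → ℕ)
    (hWdef : ∀ n i ω, W n i ω = numCopies (SimpleGraph.cycleGraph (k i)) (erGraph ω))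
    (lam : ℕ → Fin d → ℝ)
    (hlam : ∀ n i, lam n i = ∫ ω, (W n i ω : ℝ) ∂erMeasure n (p n)) :
    (∀ n i, lam n i = (n.descFactorial (k i) : ℝ) / (2 * (k i : ℝ)) * (p n) ^ (k i))
      ∧ (∀ i, Tendsto (fun n => lam n i) atTop (nhds (c ^ (k i) / (2 * (k i : ℝ)))))
      ∧ ∃ C > (0 : ℝ), ∀ᶠ n in atTop,
          distW (Measure.map (fun ω i => W n i ω) (erMeasure n (p n))) (poissonPi (lam n))
            ≤ ENNReal.ofReal (C * (n : ℝ)⁻¹) := by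
  obtain ⟨m, rfl⟩ : ∃ m : Fin d → ℕ, k = fun i => m i + 3 :=
    ⟨fun i => k i - 3, by ext i; have := hk3 i; dsimp only; omega⟩
  have hminj : ∀ i j, m i = m j → i = j := by
    intro i j h
    exact hkmono.injective (by simp [h])
  have hW : ∀ n ω, (fun i => W n i ω) = cntW (fun i => cycSet n (m i)) ω := by
    intro n ω
    ext i
    rw [hWdef, numCopies_eq]
    unfold cntW
    congr
  have hl : ∀ n i, lam n i = ∑ S ∈ cycSet n (m i), (p n) ^ S.card := by
    intro n i
    have hW' : ∀ ω, W n i ω = cntW (fun i => cycSet n (m i)) ω i := fun ω => congrFun (hW n ω) i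
    rw [hlam]
    have := bernoulliB_prob (hp n).1.le (hp n).2.le
    unfold erMeasure
    simp_rw [hW', cntW_cast]
    rw [integral_finsetSum _ (fun _ _ => Integrable.of_finite)]
    simp_rw [integral_ind (hp n).1.le (hp n).2.le]
  have hform : ∀ n i, lam n i = (n.descFactorial (m i + 3) : ℝ) / (2 * ((m i + 3 : ℕ) : ℝ)) * (p n) ^ (m i + 3) := by
    intro n i
    rw [hl, lam_formula]
  have hnp := np_tendsto c hc p hpc
  have hlim : ∀ i, Tendsto (fun n => lam n i) atTop (nhds (c ^ (m i + 3) / (2 * ((m i + 3 : ℕ) : ℝ)))) := by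
    intro i
    simp_rw [hform]
    exact lam_tendsto c hc p hnp _
  refine ⟨hform, hlim, ?_⟩
  set M : Fin d → ℝ := fun i => c ^ (m i + 3) / (2 * ((m i + 3 : ℕ) : ℝ)) + 1 with hM
  have hM0 : ∀ i, 0 ≤ M i := fun i => by simp only [hM]; positivity
  set Q : Fin d → ℝ := fun i => 1 + ∑ j, (((m i + 3 : ℕ) : ℝ) + (c + 1)) ^ (m j + 3) with hQ
  have hQ0 : ∀ i, 0 ≤ Q i := fun i => by simp only [hQ]; positivity
  set R : ℝ := ∑ i, 2 * (1 + M i) * Real.exp (M i) * (M i * (Q i * (c + 1))) with hR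
  have hR0 : 0 ≤ R := Finset.sum_nonneg fun i _ => by
    have := hM0 i
    have := hQ0 i
    positivity
  refine ⟨R + 1, by linarith, ?_⟩
  have ev1 : ∀ᶠ n : ℕ in atTop, n * p n ≤ c + 1 := hnp.eventually_le_const (by linarith)
  have ev2 : ∀ᶠ n in atTop, ∀ i, lam n i ≤ M i := by
    rw [eventually_all]
    intro i
    exact (hlim i).eventually_le_const (by simp only [hM]; linarith)
  filter_upwards [ev1, ev2, eventually_gt_atTop 0] with n h1 h2 hn
  have hp0 := (hp n).1.le
  have hp1 := (hp n).2.le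
  have hn' : (0:ℝ) < n := by exact_mod_cast hn
  have hpn : p n ≤ (c + 1) * (n:ℝ)⁻¹ := by
    rw [← div_eq_mul_inv, le_div_iff₀ hn']; linarith
  have hWW : (fun ω i => W n i ω) = fun ω => cntW (fun i => cycSet n (m i)) ω := funext (hW n)
  rw [hWW]
  have hmem : ∀ (q : ℕ) S, S ∈ cycSet n q → ∃ b : Fin (q+3) ↪ Fin n, cyc b = S := by
    intro q S hS
    simpa [cycSet] using hS
  refine (abstract_bound hp0 hp1 (fun i => cycSet n (m i)) ?_ (lam n) (hl n)
    (fun i => p n * Q i) ?_).trans ?_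
  · intro i j S hij hi hj
    obtain ⟨b, hb⟩ := hmem _ _ hi
    obtain ⟨b', hb'⟩ := hmem _ _ hj
    have e1 := card_cyc b
    have e2 := card_cyc b'
    rw [hb] at e1
    rw [hb', e1] at e2
    exact hij (hminj j i (by omega))
  · intro i S hS
    obtain ⟨b, rfl⟩ := hmem _ _ hS
    simp only [hQ, mul_add, mul_one, Finset.mul_sum]
    apply add_le_add
    · rw [card_cyc]
      exact pow_le_of_le_one hp0 hp1 (by omega)
    · apply Finset.sum_le_sum
      intro j _
      refine (overlap_sum (m' := m j) hp0 hp1 b).trans ?_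
      apply mul_le_mul_of_nonneg_left _ hp0
      apply pow_le_pow_left₀ (by positivity)
      linarith
  · apply ENNReal.ofReal_le_ofReal
    have : R * (n:ℝ)⁻¹ ≤ (R + 1) * (n:ℝ)⁻¹ := by
      apply mul_le_mul_of_nonneg_right (by linarith) (by positivity)
    refine le_trans ?_ this
    rw [hR, Finset.sum_mul]
    apply Finset.sum_le_sum
    intro i _
    have hl0 : 0 ≤ lam n i := by rw [hl]; exact Finset.sum_nonneg fun _ _ => by positivity
    have a1 := h2 i
    have a2 := hM0 i
    have a3 := hQ0 i
    calc 2 * (1 + lam n i) * Real.exp (lam n i) * (lam n i * (p n * Q i))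
        ≤ 2 * (1 + M i) * Real.exp (M i) * (M i * (((c + 1) * (n:ℝ)⁻¹) * Q i)) := by
          gcongr
      _ = _ := by ring
end
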